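/- arXiv:2509.16514 — 2 statements merged into one kernel-verified Lean document; each statement's English description precedes it below -/
import Mathlib

section
/- Let n and m be integers with n ≥ 4 and 5 ≤ m ≤ C(n,2). Then the set T_{n,m} contains a locally most reliable two-terminal graph, and it is unique up to isomorphism of two-terminal graphs (isomorphism of graphs mapping terminals to terminals). -/
noncomputable def edgeCount {V : Type} (G : SimpleGraph V) : ℕ := G.edgeSet.ncard

noncomputable def M1 {V : Type} [Fintype V] (G : SimpleGraph V) : ℕ :=
  ∑ v : V, (G.neighborSet v).ncard ^ 2

open Classical in
/-- Second Zagreb index: each unordered edge counted once (ordered sum halved). -/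
noncomputable def M2 {V : Type} [Fintype V] (G : SimpleGraph V) : ℕ :=
  (∑ u : V, ∑ v : V,
    if G.Adj u v then (G.neighborSet u).ncard * (G.neighborSet v).ncard else 0) / 2

noncomputable def k3 {V : Type} [Fintype V] (G : SimpleGraph V) : ℕ :=
  {s : Finset V | G.IsNClique 3 s}.ncard

noncomputable def Hval {V : Type} [Fintype V] (G : SimpleGraph V) : ℤ :=
  (M2 G : ℤ) - 6 * (k3 G : ℤ)

/-- `G` is M-optimal among simple graphs on `V` with `m` edges. -/
def MOptimal {V : Type} [Fintype V] (m : ℕ) (G : SimpleGraph V) : Prop :=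
  edgeCount G = m ∧ ∀ G' : SimpleGraph V, edgeCount G' = m → M1 G' ≤ M1 G

/-- `G` is H-optimal among simple graphs on `V` with `m` edges. -/
def HOptimal {V : Type} [Fintype V] (m : ℕ) (G : SimpleGraph V) : Prop :=
  MOptimal m G ∧ ∀ G' : SimpleGraph V, MOptimal m G' → Hval G' ≤ Hval G

/-- A two-terminal graph on `n` labeled vertices. -/
structure TwoTerminalGraph (n : ℕ) where
  graph : SimpleGraph (Fin n)
  s : Fin n
  t : Fin n
  hst : s ≠ t

/-- The set of two-terminal graphs on `n` vertices with `m` edges. -/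
def TT (n m : ℕ) : Set (TwoTerminalGraph n) := {G | edgeCount G.graph = m}

/-- `Ncoeff G i` = number of `i`-edge subsets `F` of `E(G)` such that the terminals
are joined by a path in the spanning subgraph `(V, F)`. -/
noncomputable def Ncoeff {n : ℕ} (G : TwoTerminalGraph n) (i : ℕ) : ℕ :=
  {F : Set (Sym2 (Fin n)) | F ⊆ G.graph.edgeSet ∧ F.ncard = i ∧
    (SimpleGraph.fromEdgeSet F).Reachable G.s G.t}.ncard

/-- Two-terminal reliability at `p`, for a graph with `m` edges. -/
noncomputable def relia {n : ℕ} (m : ℕ) (G : TwoTerminalGraph n) (p : ℝ) : ℝ :=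
  ∑ i ∈ Finset.Icc 1 m, (Ncoeff G i : ℝ) * p ^ i * (1 - p) ^ (m - i)

/-- Locally most reliable two-terminal graph in `TT n m`. -/
def IsLMRTTG (n m : ℕ) (G : TwoTerminalGraph n) : Prop :=
  G ∈ TT n m ∧ ∀ H ∈ TT n m, ∃ δ > 0, ∀ p ∈ Set.Ioo (0:ℝ) δ, relia m H p ≤ relia m G p

/-- Isomorphism of two-terminal graphs: a graph isomorphism mapping terminals to terminals. -/
def TTIso {n : ℕ} (G H : TwoTerminalGraph n) : Prop :=
  ∃ e : G.graph ≃g H.graph, (e G.s = H.s ∧ e G.t = H.t) ∨ (e G.s = H.t ∧ e G.t = H.s)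

/-- The iterated maximizing subsets `T_{n,m}^{(i)}`. -/
def TTfilter (n m : ℕ) : ℕ → Set (TwoTerminalGraph n)
  | 0 => TT n m
  | i + 1 => {G ∈ TTfilter n m i | ∀ H ∈ TTfilter n m i, Ncoeff H (i+1) ≤ Ncoeff G (i+1)}

/-- The quasi-complete graph `C¹_{n,m}` with parameters `k, j`
(`m = C(k+1,2) − j`, `1 ≤ j ≤ k`): a `K_k` on vertices `0..k-1`, one extra vertex `k`
adjacent to exactly `k−j` vertices of the clique, and `n−k−1` isolated vertices. -/
def quasiComplete (n k j : ℕ) : SimpleGraph (Fin n) :=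
  SimpleGraph.fromRel (fun a b => (a.val < k ∧ b.val < k) ∨ (a.val = k ∧ b.val < k - j))

/-- The quasi-star graph `S¹_{n,m}` with parameters `k', j'`
(`m = C(n,2) − C(k'+1,2) + j'`): the complement of the quasi-complete graph,
i.e. `K_{n−k'−1} ∨ ((K_1 ∨ j'K_1) ∪ (k'−j')K_1)`. -/
def quasiStar (n k' j' : ℕ) : SimpleGraph (Fin n) := (quasiComplete n k' j')ᶜ

/-- `S²_{n,m} = K_{n−2k'+j'} ∨ ((K_{k'−j'} ∨ (k'−1)K_1) ∪ K_1)`. -/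
def quasiStar2 (n k' j' : ℕ) : SimpleGraph (Fin n) :=
  SimpleGraph.fromRel (fun x y =>
    x.val < n - 2*k' + j' ∨
    (n - 2*k' + j' ≤ x.val ∧ x.val < n - k' ∧ n - 2*k' + j' ≤ y.val ∧ y.val < n - k') ∨
    (n - 2*k' + j' ≤ x.val ∧ x.val < n - k' ∧ n - k' ≤ y.val ∧ y.val < n - 1))

/-- `S³_{n,m} = K_{n−k'−1} ∨ (K_3 ∪ (k'−2)K_1)` (defined when `j' = 3`). -/
def quasiStar3 (n k' : ℕ) : SimpleGraph (Fin n) :=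
  SimpleGraph.fromRel (fun x y =>
    x.val < n - k' - 1 ∨
    (n - k' - 1 ≤ x.val ∧ x.val < n - k' + 2 ∧ n - k' - 1 ≤ y.val ∧ y.val < n - k' + 2))

/-- `C³_{n,m} = (K_{k−2} ∨ 3K_1) ∪ (n−k−1)K_1` (defined when `j = 3`). -/
def quasiComplete3 (n k : ℕ) : SimpleGraph (Fin n) :=
  SimpleGraph.fromRel (fun x y =>
    (x.val < k - 2 ∧ y.val < k - 2) ∨ (x.val < k - 2 ∧ k - 2 ≤ y.val ∧ y.val < k + 1))

noncomputable def pPoly (x : ℝ) : ℝ :=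
  (1/8) * ((3 - 2*Real.sqrt 2)*x^4 - (20 + 37*Real.sqrt 2)*x^3
    + (19 + 76*Real.sqrt 2)*x^2 - (46 + 226*Real.sqrt 2)*x + 72)

noncomputable def qPoly (x : ℝ) : ℝ :=
  (1/8) * (2*Real.sqrt 2*x^3 - 2*x^2 - 16*Real.sqrt 2*x + 4)

/-- The family `S^i_{n,m}` for `i ∈ {1,2,3}`. -/
def Sfam (n k' j' : ℕ) : ℕ → SimpleGraph (Fin n)
  | 1 => quasiStar n k' j'
  | 2 => quasiStar2 n k' j'
  | 3 => quasiStar3 n k'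
  | _ => ⊥

/-- Existence conditions for `S^i_{n,m}`, `i ∈ {1,2,3}`. -/
def SExists (n k' j' : ℕ) : ℕ → Prop
  | 1 => True
  | 2 => k' + 1 ≤ 2*k' - j' - 1 ∧ 2*k' - j' - 1 ≤ n - 1
  | 3 => j' = 3
  | _ => False


open Classical in
/-- joined by a path in the graph with edge set F -/
def cn {V : Type} (s t : V) (F : Finset (Sym2 V)) : Prop :=
  (SimpleGraph.fromEdgeSet (F : Set (Sym2 V))).Reachable s t

theorem cn_refl {V : Type} (s : V) (F : Finset (Sym2 V)) : cn s s F := SimpleGraph.Reachable.refl _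

theorem cn_symm {V : Type} {s t : V} {F : Finset (Sym2 V)} (h : cn s t F) : cn t s F :=
  SimpleGraph.Reachable.symm h

theorem cn_trans {V : Type} {s t u : V} {F : Finset (Sym2 V)} (h : cn s t F) (h' : cn t u F) :
    cn s u F := SimpleGraph.Reachable.trans h h'

theorem cn_mono {V : Type} {s t : V} {F F' : Finset (Sym2 V)} (hF : F ⊆ F') (h : cn s t F) :
    cn s t F' :=
  SimpleGraph.Reachable.mono (SimpleGraph.fromEdgeSet_mono (by exact_mod_cast hF)) h

theorem cn_edge {V : Type} {s t : V} {F : Finset (Sym2 V)} (h : s(s, t) ∈ F) : cn s t F := by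
  by_cases hst : s = t
  · subst hst; exact cn_refl _ _
  · exact SimpleGraph.Adj.reachable (by simp [SimpleGraph.fromEdgeSet_adj, h, hst])

theorem cn_closed {V : Type} {s t : V} {F : Finset (Sym2 V)} (h : cn s t F) (X : Set V)
    (hs : s ∈ X) (hX : ∀ a b, s(a, b) ∈ F → a ∈ X → b ∈ X) : t ∈ X := by
  obtain ⟨w⟩ := h
  induction w with
  | nil => exact hs
  | cons hadj p ih =>
    apply ih
    rw [SimpleGraph.fromEdgeSet_adj] at hadj
    exact hX _ _ (by exact_mod_cast hadj.1) hs

theorem cn_map {V : Type} [DecidableEq V] (σ : Equiv.Perm V) {s t : V} {F : Finset (Sym2 V)}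
    (h : cn s t F) : cn (σ s) (σ t) (F.image (Sym2.map σ)) := by
  refine cn_closed h {x | cn (σ s) (σ x) (F.image (Sym2.map σ))} (cn_refl _ _) ?_
  intro a b hab ha
  refine cn_trans ha (cn_edge ?_)
  rw [Finset.mem_image]
  exact ⟨_, hab, by simp⟩

theorem cn_map_iff {V : Type} [DecidableEq V] (σ : Equiv.Perm V) {s t : V} {F : Finset (Sym2 V)} :
    cn (σ s) (σ t) (F.image (Sym2.map σ)) ↔ cn s t F := by
  refine ⟨fun h => ?_, cn_map σ⟩
  have := cn_map σ⁻¹ h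
  have h2 : (Sym2.map ⇑σ⁻¹ ∘ Sym2.map ⇑σ) = (id : Sym2 V → Sym2 V) := by
    rw [← Sym2.map_comp]
    have : (⇑σ⁻¹ ∘ ⇑σ) = id := by ext x; simp
    rw [this, Sym2.map_id]
  rw [Finset.image_image, h2, Finset.image_id] at this
  simpa using this

open Classical in
noncomputable def NF {V : Type} (s t : V) (E : Finset (Sym2 V)) (i : ℕ) : ℕ :=
  ((E.powersetCard i).filter (cn s t)).card

open Classical in
noncomputable def EF {n : ℕ} (G : TwoTerminalGraph n) : Finset (Sym2 (Fin n)) :=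
  G.graph.edgeSet.toFinset

theorem mem_EF {n : ℕ} (G : TwoTerminalGraph n) (a b : Fin n) :
    s(a, b) ∈ EF G ↔ G.graph.Adj a b := by
  simp [EF]

theorem card_EF {n : ℕ} (G : TwoTerminalGraph n) : (EF G).card = edgeCount G.graph := by
  classical
  unfold EF edgeCount
  rw [Set.ncard_eq_toFinset_card']

theorem Ncoeff_eq {n : ℕ} (G : TwoTerminalGraph n) (i : ℕ) :
    Ncoeff G i = NF G.s G.t (EF G) i := by
  classical
  unfold Ncoeff NF
  symm
  rw [← Set.ncard_coe_finset]
  refine Set.ncard_congr (fun F _ => (F : Set (Sym2 (Fin n)))) ?_ ?_ ?_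
  · intro F hF
    simp only [Finset.coe_filter, Finset.mem_powersetCard, Set.mem_ofPred_eq] at hF ⊢
    refine ⟨?_, ?_, hF.2⟩
    · intro x hx
      have := hF.1.1 (by exact_mod_cast hx)
      simpa [EF] using this
    · rw [Set.ncard_coe_finset]; exact hF.1.2
  · intro F F' _ _ h
    exact_mod_cast h
  · intro F hF
    refine ⟨F.toFinset, ?_, by simp⟩
    simp only [Finset.coe_filter, Finset.mem_powersetCard, Set.mem_ofPred_eq] at hF ⊢
    refine ⟨⟨?_, ?_⟩, ?_⟩
    · intro x hx
      have := hF.1 (by simpa using hx)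
      simpa [EF] using this
    · rw [← Set.ncard_eq_toFinset_card']; exact hF.2.1
    · unfold cn; simpa using hF.2.2

/-- two-terminal graph from a set of edges -/
def mkG {n : ℕ} (s t : Fin n) (h : s ≠ t) (E : Finset (Sym2 (Fin n))) : TwoTerminalGraph n :=
  ⟨SimpleGraph.fromEdgeSet (E : Set (Sym2 (Fin n))), s, t, h⟩

theorem EF_mkG {n : ℕ} (s t : Fin n) (h : s ≠ t) (E : Finset (Sym2 (Fin n)))
    (hE : ∀ e ∈ E, ¬ e.IsDiag) : EF (mkG s t h E) = E := by
  classical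
  ext e
  induction e with | _ a b =>
  rw [mem_EF]
  simp only [mkG, SimpleGraph.fromEdgeSet_adj, Finset.mem_coe]
  constructor
  · exact fun h => h.1
  · exact fun h => ⟨h, fun hab => hE _ h (by simpa using hab)⟩

theorem EF_not_diag {n : ℕ} (G : TwoTerminalGraph n) : ∀ e ∈ EF G, ¬ e.IsDiag := by
  intro e he
  induction e with | _ a b =>
  rw [mem_EF] at he
  simpa using he.ne

theorem NF_gt {V : Type} (s t : V) (E : Finset (Sym2 V)) (i : ℕ) (h : E.card < i) :
    NF s t E i = 0 := by
  unfold NF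
  rw [Finset.powersetCard_eq_empty.2 h]; simp

theorem NF_zero {V : Type} (s t : V) (hst : s ≠ t) (E : Finset (Sym2 V)) :
    NF s t E 0 = 0 := by
  classical
  unfold NF
  rw [Finset.powersetCard_zero, Finset.card_eq_zero, Finset.filter_eq_empty_iff]
  intro F hF h
  simp only [Finset.mem_singleton] at hF
  subst hF
  exact hst (cn_closed h {s} rfl (by simp)).symm

theorem pos_lemma (m k : ℕ) (hk1 : 1 ≤ k) (hkm : k ≤ m) (d : ℕ → ℝ)
    (h0 : ∀ j < k, d j = 0) (hk : 0 < d k) :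
    ∃ δ > 0, ∀ p ∈ Set.Ioo (0:ℝ) δ,
      0 < ∑ i ∈ Finset.Icc 1 m, d i * p ^ i * (1 - p) ^ (m - i) := by
  let f : ℝ → ℝ := fun p => ∑ i ∈ Finset.Icc k m, d i * p ^ (i - k) * (1 - p) ^ (m - i)
  have hf : Continuous f := by fun_prop
  have hf0 : 0 < f 0 := by
    have : f 0 = d k := by
      simp only [f]
      rw [Finset.sum_eq_single k]
      · simp
      · intro b hb hbk
        have : b - k ≠ 0 := by simp at hb; omega
        simp [this]
      · intro h; exact absurd (Finset.mem_Icc.2 ⟨le_rfl, hkm⟩) h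
    rw [this]; exact hk
  have hev : ∀ᶠ p in nhds (0:ℝ), 0 < f p := hf.continuousAt.eventually (lt_mem_nhds hf0)
  obtain ⟨δ, hδ, hb⟩ := Metric.eventually_nhds_iff.1 hev
  refine ⟨δ, hδ, fun p hp => ?_⟩
  have hfp : 0 < f p := hb (by simp [abs_of_pos hp.1, hp.2])
  have heq : ∑ i ∈ Finset.Icc 1 m, d i * p ^ i * (1 - p) ^ (m - i) = p ^ k * f p := by
    simp only [f]
    rw [Finset.mul_sum]
    have hss := Finset.sum_subset (s₁ := Finset.Icc k m) (s₂ := Finset.Icc 1 m)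
      (f := fun i => d i * p ^ i * (1 - p) ^ (m - i)) (Finset.Icc_subset_Icc hk1 le_rfl) (by
        intro i hi hi'
        have hik : i < k := by
          by_contra hc
          exact hi' (Finset.mem_Icc.2 ⟨by omega, (Finset.mem_Icc.1 hi).2⟩)
        simp [h0 i hik])
    rw [← hss]
    · apply Finset.sum_congr rfl
      intro i hi
      have : p ^ i = p ^ k * p ^ (i - k) := by
        rw [← pow_add]; congr 1; simp at hi; omega
      rw [this]; ring
  rw [heq]
  exact mul_pos (pow_pos hp.1 _) hfp

theorem relia_lt {n m k : ℕ} (hk1 : 1 ≤ k) (hkm : k ≤ m) (G H : TwoTerminalGraph n)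
    (h0 : ∀ j < k, Ncoeff G j = Ncoeff H j) (hk : Ncoeff H k < Ncoeff G k) :
    ∃ δ > 0, ∀ p ∈ Set.Ioo (0:ℝ) δ, relia m H p < relia m G p := by
  obtain ⟨δ, hδ, h⟩ := pos_lemma m k hk1 hkm (fun i => (Ncoeff G i : ℝ) - Ncoeff H i)
    (fun j hj => by simp [h0 j hj]) (by simpa using hk)
  refine ⟨δ, hδ, fun p hp => ?_⟩
  have := h p hp
  unfold relia
  rw [← sub_pos, ← Finset.sum_sub_distrib]
  convert this using 2
  ring

theorem Ncoeff_range {n m : ℕ} {G : TwoTerminalGraph n} (hG : G ∈ TT n m) {k : ℕ}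
    (hk : Ncoeff G k ≠ 0) : 1 ≤ k ∧ k ≤ m := by
  rw [Ncoeff_eq] at hk
  constructor
  · by_contra h
    have : k = 0 := by omega
    subst this
    exact hk (NF_zero _ _ G.hst _)
  · by_contra h
    exact hk (NF_gt _ _ _ _ (by rw [card_EF]; have : edgeCount G.graph = m := hG; omega))

theorem lex_le {n m k : ℕ} {G H : TwoTerminalGraph n} (hG : IsLMRTTG n m G) (hH : H ∈ TT n m)
    (h0 : ∀ j < k, Ncoeff G j = Ncoeff H j) : Ncoeff H k ≤ Ncoeff G k := by
  by_contra hlt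
  push Not at hlt
  have hr := Ncoeff_range hH (k := k) (by omega)
  obtain ⟨δ, hδ, h⟩ := relia_lt hr.1 hr.2 H G (fun j hj => (h0 j hj).symm) hlt
  obtain ⟨δ', hδ', h'⟩ := hG.2 H hH
  have hm : 0 < min δ δ' / 2 := by positivity
  have h1 := h (min δ δ' / 2) ⟨hm, by have := min_le_left δ δ'; linarith⟩
  have h2 := h' (min δ δ' / 2) ⟨hm, by have := min_le_right δ δ'; linarith⟩
  linarith

theorem opt_eq {n m : ℕ} {G H : TwoTerminalGraph n} (hG : IsLMRTTG n m G) (hH : IsLMRTTG n m H) :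
    ∀ k, Ncoeff G k = Ncoeff H k := by
  intro k
  induction k using Nat.strong_induction_on with
  | _ k ih =>
    exact le_antisymm (lex_le hH hG.1 (fun j hj => (ih j hj).symm)) (lex_le hG hH.1 ih)

/-- domination: if all coefficients of `H` are at least those of `G`, they are equal -/
theorem dom_eq {n m : ℕ} {G H : TwoTerminalGraph n} (hG : IsLMRTTG n m G) (hH : H ∈ TT n m)
    (hle : ∀ k, Ncoeff G k ≤ Ncoeff H k) : ∀ k, Ncoeff G k = Ncoeff H k := by
  intro k
  induction k using Nat.strong_induction_on with
  | _ k ih => exact le_antisymm (hle k) (lex_le hG hH ih)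

instance {n : ℕ} : Finite (TwoTerminalGraph n) := by
  apply Finite.of_injective (fun G : TwoTerminalGraph n => (G.graph, G.s, G.t))
  rintro ⟨g, s, t, h⟩ ⟨g', s', t', h'⟩ heq
  simp only [Prod.mk.injEq] at heq
  obtain ⟨rfl, rfl, rfl⟩ := heq
  rfl

theorem exists_opt {n m : ℕ} (hne : (TT n m).Nonempty) : ∃ G, IsLMRTTG n m G := by
  classical
  let f : TwoTerminalGraph n → Lex (Fin (m + 1) → ℕ) := fun G => toLex (fun i => Ncoeff G i)
  obtain ⟨G, hG, hmax⟩ := Set.exists_max_image (TT n m) f (Set.toFinite _) hne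
  refine ⟨G, hG, fun H hH => ?_⟩
  rcases (hmax H hH).lt_or_eq with hlt | heq
  · obtain ⟨i, hi, hlt⟩ := hlt
    simp only [f] at hi hlt
    have hlt' : Ncoeff H i < Ncoeff G i := hlt
    have hr := Ncoeff_range hG (k := i) (by omega)
    obtain ⟨δ, hδ, h⟩ := relia_lt (m := m) hr.1 hr.2 G H (fun j hj => by
      have := hi ⟨j, by omega⟩ (by rw [Fin.lt_def]; exact hj)
      exact this.symm) hlt'
    exact ⟨δ, hδ, fun p hp => (h p hp).le⟩
  · refine ⟨1, one_pos, fun p _ => le_of_eq ?_⟩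
    unfold relia
    apply Finset.sum_congr rfl
    intro i hi
    have := congrFun heq ⟨i, by simp at hi; omega⟩
    have : Ncoeff H i = Ncoeff G i := this
    rw [this]

theorem sym2_map_inj {V : Type} (σ : Equiv.Perm V) : Function.Injective (Sym2.map σ) :=
  Sym2.map.injective σ.injective

open Classical in
theorem NF_le {V : Type} (s t s' t' : V) (E E' : Finset (Sym2 V)) (φ : Sym2 V → Sym2 V)
    (hinj : Set.InjOn φ E) (hmaps : ∀ e ∈ E, φ e ∈ E') (i : ℕ)
    (h : ∀ F ⊆ E, F.card = i → cn s t F → cn s' t' (F.image φ)) :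
    NF s t E i ≤ NF s' t' E' i := by
  unfold NF
  apply Finset.card_le_card_of_injOn (fun F => F.image φ)
  · intro F hF
    simp only [Finset.coe_filter, Finset.mem_powersetCard, Set.mem_ofPred_eq] at hF ⊢
    refine ⟨⟨?_, ?_⟩, h F hF.1.1 hF.1.2 hF.2⟩
    · intro e he
      obtain ⟨e', he', rfl⟩ := Finset.mem_image.1 he
      exact hmaps _ (hF.1.1 he')
    · rw [Finset.card_image_of_injOn (hinj.mono (by exact_mod_cast hF.1.1)), hF.1.2]
  · intro F hF F' hF' heq
    simp only [Finset.coe_filter, Finset.mem_powersetCard, Set.mem_ofPred_eq] at hF hF'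
    have h1 := hinj.image_eq_image_iff (s₁ := (F : Set (Sym2 V))) (s₂ := (F' : Set (Sym2 V)))
      (by exact_mod_cast hF.1.1) (by exact_mod_cast hF'.1.1)
    have h2 : (φ '' (F : Set (Sym2 V))) = φ '' (F' : Set (Sym2 V)) := by
      have := congrArg (fun X : Finset (Sym2 V) => (X : Set (Sym2 V))) heq
      simpa using this
    exact_mod_cast h1.1 h2

open Classical in
theorem NF_lt {V : Type} (s t s' t' : V) (E E' : Finset (Sym2 V)) (φ : Sym2 V → Sym2 V)
    (hinj : Set.InjOn φ E) (hmaps : ∀ e ∈ E, φ e ∈ E') (i : ℕ)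
    (h : ∀ F ⊆ E, F.card = i → cn s t F → cn s' t' (F.image φ))
    (F₀ : Finset (Sym2 V)) (hF₀ : F₀ ⊆ E) (hc : F₀.card = i) (hn : ¬ cn s t F₀)
    (hn' : cn s' t' (F₀.image φ)) :
    NF s t E i < NF s' t' E' i := by
  unfold NF
  have himg : ∀ F F' : Finset (Sym2 V), F ⊆ E → F' ⊆ E → F.image φ = F'.image φ → F = F' := by
    intro F F' hF hF' heq
    have h1 := hinj.image_eq_image_iff (s₁ := (F : Set (Sym2 V))) (s₂ := (F' : Set (Sym2 V)))
      (by exact_mod_cast hF) (by exact_mod_cast hF')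
    have h2 : (φ '' (F : Set (Sym2 V))) = φ '' (F' : Set (Sym2 V)) := by
      have := congrArg (fun X : Finset (Sym2 V) => (X : Set (Sym2 V))) heq
      simpa using this
    exact_mod_cast h1.1 h2
  rw [← Finset.card_image_of_injOn (f := fun F : Finset (Sym2 V) => F.image φ)
    (s := (E.powersetCard i).filter (cn s t)) (by
      intro F hF F' hF' heq
      simp only [Finset.coe_filter, Finset.mem_powersetCard, Set.mem_ofPred_eq] at hF hF'
      exact himg F F' hF.1.1 hF'.1.1 heq)]
  have hgen : ∀ F ⊆ E, F.card = i → F.image φ ∈ E'.powersetCard i := by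
    intro F hF hFi
    rw [Finset.mem_powersetCard]
    refine ⟨?_, ?_⟩
    · intro e he
      obtain ⟨e', he', rfl⟩ := Finset.mem_image.1 he
      exact hmaps _ (hF he')
    · rw [Finset.card_image_of_injOn (hinj.mono (by exact_mod_cast hF)), hFi]
  apply Finset.card_lt_card
  rw [Finset.ssubset_iff_of_subset]
  · refine ⟨F₀.image φ, ?_, ?_⟩
    · rw [Finset.mem_filter]; exact ⟨hgen _ hF₀ hc, hn'⟩
    · intro hmem
      obtain ⟨F, hF, heq⟩ := Finset.mem_image.1 hmem
      rw [Finset.mem_filter, Finset.mem_powersetCard] at hF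
      have := himg F F₀ hF.1.1 hF₀ heq
      subst this
      exact hn hF.2
  · intro X hX
    obtain ⟨F, hF, rfl⟩ := Finset.mem_image.1 hX
    rw [Finset.mem_filter, Finset.mem_powersetCard] at hF
    rw [Finset.mem_filter]
    exact ⟨hgen _ hF.1.1 hF.1.2, h _ hF.1.1 hF.1.2 hF.2⟩

open Classical in
theorem NF_map {V : Type} (σ : Equiv.Perm V) (s t : V) (E : Finset (Sym2 V)) (i : ℕ) :
    NF (σ s) (σ t) (E.image (Sym2.map σ)) i = NF s t E i := by
  apply le_antisymm
  · have key := NF_le (σ s) (σ t) s t (E.image (Sym2.map σ)) E (Sym2.map ⇑(σ⁻¹))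
      (sym2_map_inj _).injOn (by
        intro e he
        obtain ⟨e', he', rfl⟩ := Finset.mem_image.1 he
        rw [Sym2.map_map]
        have : (⇑σ⁻¹ ∘ ⇑σ) = id := by ext x; simp
        rw [this, Sym2.map_id]; exact he') i (by
        intro F _ _ hF
        have := cn_map σ⁻¹ hF
        simpa using this)
    exact key
  · exact NF_le _ _ _ _ _ _ (Sym2.map σ) (sym2_map_inj _).injOn
      (fun e he => Finset.mem_image_of_mem _ he) i (fun F _ _ hF => cn_map σ hF)

def relabel {n : ℕ} (σ : Equiv.Perm (Fin n)) (G : TwoTerminalGraph n) : TwoTerminalGraph n :=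
  ⟨G.graph.comap σ.symm, σ G.s, σ G.t, fun h => G.hst (σ.injective h)⟩

theorem EF_relabel {n : ℕ} (σ : Equiv.Perm (Fin n)) (G : TwoTerminalGraph n) :
    EF (relabel σ G) = (EF G).image (Sym2.map σ) := by
  ext e
  induction e with | _ a b =>
  rw [mem_EF, Finset.mem_image]
  constructor
  · intro h
    exact ⟨s(σ.symm a, σ.symm b), by rw [mem_EF]; exact h, by simp⟩
  · rintro ⟨e, he, heq⟩
    have : e = s(σ.symm a, σ.symm b) := by
      apply sym2_map_inj σ
      rw [heq]; simp
    subst this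
    rw [mem_EF] at he
    exact he

theorem Ncoeff_relabel {n : ℕ} (σ : Equiv.Perm (Fin n)) (G : TwoTerminalGraph n) (i : ℕ) :
    Ncoeff (relabel σ G) i = Ncoeff G i := by
  classical
  rw [Ncoeff_eq, Ncoeff_eq, EF_relabel]
  have := NF_map σ G.s G.t (EF G) i
  convert this <;> rfl

theorem TT_relabel {n m : ℕ} (σ : Equiv.Perm (Fin n)) {G : TwoTerminalGraph n} (h : G ∈ TT n m) :
    relabel σ G ∈ TT n m := by
  change edgeCount _ = m
  have h : edgeCount G.graph = m := h
  rw [← card_EF, EF_relabel, Finset.card_image_of_injective _ (sym2_map_inj σ), card_EF, h]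

theorem opt_relabel {n m : ℕ} (σ : Equiv.Perm (Fin n)) {G : TwoTerminalGraph n}
    (h : IsLMRTTG n m G) : IsLMRTTG n m (relabel σ G) := by
  refine ⟨TT_relabel σ h.1, fun H hH => ?_⟩
  have : ∀ p, relia m (relabel σ G) p = relia m G p := by
    intro p; unfold relia; simp only [Ncoeff_relabel]
  simp only [this]
  exact h.2 H hH

theorem relabel_relabel {n : ℕ} (σ τ : Equiv.Perm (Fin n)) (G : TwoTerminalGraph n) :
    relabel τ (relabel σ G) = relabel (τ * σ) G := rfl

theorem iso_of_relabel {n : ℕ} (σ : Equiv.Perm (Fin n)) (G H : TwoTerminalGraph n)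
    (h : relabel σ H = G) : TTIso G H := by
  subst h
  refine ⟨⟨σ.symm, ?_⟩, Or.inl ⟨?_, ?_⟩⟩
  · intro a b; exact Iff.rfl
  · change σ.symm (σ H.s) = H.s; simp
  · change σ.symm (σ H.t) = H.t; simp

theorem ttg_ext {n : ℕ} {G H : TwoTerminalGraph n} (hs : G.s = H.s) (ht : G.t = H.t)
    (h : ∀ a b, G.graph.Adj a b ↔ H.graph.Adj a b) : G = H := by
  obtain ⟨g, s, t, hst⟩ := G
  obtain ⟨g', s', t', hst'⟩ := H
  simp only at hs ht h
  subst hs ht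
  have : g = g' := by ext a b; exact h a b
  subst this; rfl

/-- two colourings with equal fibre sizes differ by a permutation -/
theorem exists_perm_of_fibers {V ι : Type} [Fintype V] [DecidableEq ι] (κ κ' : V → ι)
    (h : ∀ i, (Finset.univ.filter (fun v => κ v = i)).card =
      (Finset.univ.filter (fun v => κ' v = i)).card) :
    ∃ σ : Equiv.Perm V, ∀ v, κ' (σ v) = κ v := by
  have e : ∀ i, Nonempty ({x // κ x = i} ≃ {x // κ' x = i}) := by
    intro i
    refine ⟨Fintype.equivOfCardEq ?_⟩
    rw [Fintype.card_subtype, Fintype.card_subtype, h i]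
  replace e := fun i => (e i).some
  refine ⟨(Equiv.sigmaFiberEquiv κ).symm.trans
    ((Equiv.sigmaCongrRight e).trans (Equiv.sigmaFiberEquiv κ')), fun v => ?_⟩
  have := (e (κ v) ⟨v, rfl⟩).2
  simpa [Equiv.sigmaFiberEquiv] using this

def IW {V : Type} (W : Finset V) (e : Sym2 V) : Prop := ∀ x ∈ e, x ∈ W

theorem IW_mk {V : Type} (W : Finset V) (a b : V) : IW W s(a, b) ↔ a ∈ W ∧ b ∈ W := by
  simp [IW]

open Classical in
theorem lb {V : Type} [Fintype V] (s t : V) (hst : s ≠ t) (E F : Finset (Sym2 V))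
    (W R : Finset V) (hsR : s ∈ R) (htR : t ∈ R) (hRW : ∀ z ∈ R, z ∉ W)
    (hs : ∀ v, v ≠ s → s(s, v) ∈ E) (ht : ∀ v, v ≠ t → s(t, v) ∈ E)
    (hR : ∀ z ∈ R, ∀ w ∈ W, s(z, w) ∈ E)
    (v₁ : V) (hv₁ : v₁ ∈ W) (hd : ∀ w ∈ W, w ≠ v₁ → s(v₁, w) ∈ E)
    (hF : ¬ cn s t F) (a b : V) (ha : a ∈ W) (hb : b ∈ W)
    (hab : ¬ cn a b (F.filter (fun e => ¬ IW W e))) :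
    Fintype.card V + R.card ≤ (E \ F).card + 2 := by
  let h : V → Sym2 V := fun v => if cn s v F then s(t, v) else s(s, v)
  have hsW := hRW s hsR
  have htW := hRW t htR
  have hchoose : ∀ z ∈ R, ∃ w ∈ ({a, b} : Finset V), s(z, w) ∉ F := by
    intro z hz
    by_contra hcon
    push Not at hcon
    have h1 := hcon a (by simp)
    have h2 := hcon b (by simp)
    apply hab
    have hzW := hRW z hz
    refine cn_trans (cn_symm (s := z) (cn_edge ?_)) (cn_edge (s := z) ?_)
    · rw [Finset.mem_filter, IW_mk]; exact ⟨h1, fun h => hzW h.1⟩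
    · rw [Finset.mem_filter, IW_mk]; exact ⟨h2, fun h => hzW h.1⟩
  have hmemW : ∀ w ∈ ({a, b} : Finset V), w ∈ W := by
    intro w hw
    simp only [Finset.mem_insert, Finset.mem_singleton] at hw
    rcases hw with rfl | rfl <;> assumption
  choose! k hk1 hk2 using hchoose
  let T2 := (Finset.univ.erase s).image h
  let T3 := ((R.erase s).erase t).image (fun z => s(z, k z))
  have hT2 : T2.card = Fintype.card V - 1 := by
    rw [Finset.card_image_of_injOn, Finset.card_erase_of_mem (Finset.mem_univ _), Finset.card_univ]
    intro x hx y hy hxy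
    simp only [Finset.coe_erase, Finset.coe_univ, Set.mem_sdiff, Set.mem_univ,
      Set.mem_singleton_iff, true_and] at hx hy
    simp only [h] at hxy
    split_ifs at hxy with h1 h2 h2 <;> simp [Sym2.eq_iff] at hxy <;> grind
  have hT3 : T3.card = R.card - 2 := by
    rw [Finset.card_image_of_injOn, Finset.card_erase_of_mem, Finset.card_erase_of_mem hsR]
    · omega
    · simp [htR, hst.symm]
    · intro x hx y hy hxy
      simp only [Finset.coe_erase, Set.mem_sdiff, Finset.mem_coe, Set.mem_singleton_iff] at hx hy
      have := hRW x hx.1.1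
      have := hmemW _ (hk1 y hy.1.1)
      have := hmemW _ (hk1 x hx.1.1)
      simp only [Sym2.eq_iff] at hxy
      grind
  have hT2s : T2 ⊆ E \ F := by
    intro e he
    obtain ⟨v, hv, rfl⟩ := Finset.mem_image.1 he
    have hvs : v ≠ s := by simpa using hv
    simp only [h, Finset.mem_sdiff]
    split_ifs with h1
    · have hvt : v ≠ t := fun hvt => hF (hvt ▸ h1)
      refine ⟨ht v hvt, fun hmem => hF (cn_trans h1 (cn_symm (cn_edge hmem)))⟩
    · exact ⟨hs v hvs, fun hmem => h1 (cn_edge hmem)⟩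
  have hT3s : T3 ⊆ E \ F := by
    intro e he
    obtain ⟨z, hz, rfl⟩ := Finset.mem_image.1 he
    have hzR : z ∈ R := by simp at hz; exact hz.2.2
    rw [Finset.mem_sdiff]
    exact ⟨hR z hzR _ (hmemW _ (hk1 z hzR)), hk2 z hzR⟩
  have hdisj : Disjoint T2 T3 := by
    rw [Finset.disjoint_left]
    intro e he he'
    obtain ⟨v, hv, rfl⟩ := Finset.mem_image.1 he
    obtain ⟨z, hz, heq⟩ := Finset.mem_image.1 he'
    simp only [Finset.mem_erase] at hz
    have := hmemW _ (hk1 z hz.2.2)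
    simp only [h] at heq
    split_ifs at heq <;> simp only [Sym2.eq_iff] at heq <;> grind
  have hx : ∃ x ∈ E \ F, x ∉ T2 ∧ x ∉ T3 := by
    have hT3not : ∀ c w, (c = s ∨ c = t ∨ c ∈ W) → w ∈ W → s(c, w) ∉ T3 := by
      intro c w hc hw hmem
      obtain ⟨z, hz, heq⟩ := Finset.mem_image.1 hmem
      simp only [Finset.mem_erase] at hz
      have h1 := hRW z hz.2.2
      have h2 := hmemW _ (hk1 z hz.2.2)
      simp only [Sym2.eq_iff] at heq
      grind
    by_cases hsa : cn s a F <;> by_cases hsb : cn s b F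
    · have hkW := hmemW _ (hk1 s hsR)
      refine ⟨s(s, k s), ?_, ?_, hT3not _ _ (Or.inl rfl) hkW⟩
      · rw [Finset.mem_sdiff]
        exact ⟨hR s hsR _ hkW, hk2 s hsR⟩
      · intro hmem
        obtain ⟨v, hv, heq⟩ := Finset.mem_image.1 hmem
        have hsk : cn s (k s) F := by
          have := hk1 s hsR
          simp only [Finset.mem_insert, Finset.mem_singleton] at this
          rcases this with h | h <;> rw [h] <;> assumption
        simp only [Finset.mem_erase] at hv
        simp only [h] at heq
        split_ifs at heq <;> simp only [Sym2.eq_iff] at heq <;> grind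
    · by_cases hv : cn s v₁ F
      · refine ⟨s(v₁, b), ?_, ?_, hT3not _ _ (Or.inr (Or.inr hv₁)) hb⟩
        · rw [Finset.mem_sdiff]
          exact ⟨hd b hb (fun h => hsb (h ▸ hv)), fun hm => hsb (cn_trans hv (cn_edge hm))⟩
        · intro hmem
          obtain ⟨v, hv, heq⟩ := Finset.mem_image.1 hmem
          simp only [h] at heq
          split_ifs at heq <;> simp only [Sym2.eq_iff] at heq <;> grind
      · refine ⟨s(v₁, a), ?_, ?_, hT3not _ _ (Or.inr (Or.inr hv₁)) ha⟩
        · rw [Finset.mem_sdiff]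
          exact ⟨hd a ha (fun h => hv (h ▸ hsa)),
            fun hm => hv (cn_trans hsa (cn_symm (cn_edge hm)))⟩
        · intro hmem
          obtain ⟨v, hv, heq⟩ := Finset.mem_image.1 hmem
          simp only [h] at heq
          split_ifs at heq <;> simp only [Sym2.eq_iff] at heq <;> grind
    · by_cases hv : cn s v₁ F
      · refine ⟨s(v₁, a), ?_, ?_, hT3not _ _ (Or.inr (Or.inr hv₁)) ha⟩
        · rw [Finset.mem_sdiff]
          exact ⟨hd a ha (fun h => hsa (h ▸ hv)), fun hm => hsa (cn_trans hv (cn_edge hm))⟩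
        · intro hmem
          obtain ⟨v, hv, heq⟩ := Finset.mem_image.1 hmem
          simp only [h] at heq
          split_ifs at heq <;> simp only [Sym2.eq_iff] at heq <;> grind
      · refine ⟨s(v₁, b), ?_, ?_, hT3not _ _ (Or.inr (Or.inr hv₁)) hb⟩
        · rw [Finset.mem_sdiff]
          exact ⟨hd b hb (fun h => hv (h ▸ hsb)),
            fun hm => hv (cn_trans hsb (cn_symm (cn_edge hm)))⟩
        · intro hmem
          obtain ⟨v, hv, heq⟩ := Finset.mem_image.1 hmem
          simp only [h] at heq
          split_ifs at heq <;> simp only [Sym2.eq_iff] at heq <;> grind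
    · have hkW := hmemW _ (hk1 t htR)
      refine ⟨s(t, k t), ?_, ?_, hT3not _ _ (Or.inr (Or.inl rfl)) hkW⟩
      · rw [Finset.mem_sdiff]
        exact ⟨hR t htR _ hkW, hk2 t htR⟩
      · intro hmem
        obtain ⟨v, hv, heq⟩ := Finset.mem_image.1 hmem
        have hsk : ¬ cn s (k t) F := by
          have := hk1 t htR
          simp only [Finset.mem_insert, Finset.mem_singleton] at this
          rcases this with h | h <;> rw [h] <;> assumption
        simp only [Finset.mem_erase] at hv
        simp only [h] at heq
        split_ifs at heq <;> simp only [Sym2.eq_iff] at heq <;> grind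
  obtain ⟨x, hxE, hx2, hx3⟩ := hx
  have hsub : insert x (T2 ∪ T3) ⊆ E \ F := by
    intro y hy
    simp only [Finset.mem_insert, Finset.mem_union] at hy
    rcases hy with rfl | hy | hy
    · exact hxE
    · exact hT2s hy
    · exact hT3s hy
  have hcard := Finset.card_le_card hsub
  rw [Finset.card_insert_of_notMem (by simp [hx2, hx3]), Finset.card_union_of_disjoint hdisj,
    hT2, hT3] at hcard
  have h2 : 2 ≤ R.card := by
    have : ({s, t} : Finset V) ⊆ R := by
      intro x; simp; rintro (rfl | rfl) <;> assumption
    have h3 := Finset.card_le_card this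
    rwa [Finset.card_pair hst] at h3
  have h1 : 1 ≤ Fintype.card V := Fintype.card_pos_iff.2 ⟨s⟩
  omega

open Classical in
theorem key {V : Type} [Fintype V] (s t : V) (hst : s ≠ t) (E E' : Finset (Sym2 V))
    (hcard : E.card = E'.card)
    (W R : Finset V) (hsR : s ∈ R) (htR : t ∈ R) (hRW : ∀ z ∈ R, z ∉ W)
    (hs : ∀ v, v ≠ s → s(s, v) ∈ E) (ht : ∀ v, v ≠ t → s(t, v) ∈ E)
    (hR : ∀ z ∈ R, ∀ w ∈ W, s(z, w) ∈ E)
    (hR' : ∀ z, z ∉ R → z ∉ W → ∀ w ∈ W, s(z, w) ∉ E)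
    (hout : ∀ e, ¬ IW W e → (e ∈ E ↔ e ∈ E'))
    (u : V) (hu : u ∈ W) (hiso : ∀ w ∈ W, s(u, w) ∉ E) (w₀ : V) (hw₀ : w₀ ∈ W) (hne : w₀ ≠ u)
    (v₁ : V) (hv₁ : v₁ ∈ W) (hd : ∀ w ∈ W, w ≠ v₁ → s(v₁, w) ∈ E') :
    ∃ i, NF s t E i < NF s t E' i := by
  have hsW := hRW s hsR
  have htW := hRW t htR
  -- bijection of edges
  have hfilt : E.filter (fun e => ¬ IW W e) = E'.filter (fun e => ¬ IW W e) := by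
    ext e; simp only [Finset.mem_filter]
    constructor
    · rintro ⟨h1, h2⟩; exact ⟨(hout e h2).1 h1, h2⟩
    · rintro ⟨h1, h2⟩; exact ⟨(hout e h2).2 h1, h2⟩
  have hin : (E.filter (fun e => IW W e)).card = (E'.filter (fun e => IW W e)).card := by
    have h1 := Finset.card_filter_add_card_filter_not (s := E) (fun e => IW W e)
    have h2 := Finset.card_filter_add_card_filter_not (s := E') (fun e => IW W e)
    rw [hfilt] at h1
    omega
  let g := Finset.equivOfCardEq hin
  let φ : Sym2 V → Sym2 V := fun e =>
    if h : e ∈ E.filter (fun e => IW W e) then (g ⟨e, h⟩ : Sym2 V) else e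
  have hφin : ∀ e ∈ E, IW W e → φ e ∈ E' ∧ IW W (φ e) := by
    intro e he hW
    have hm : e ∈ E.filter (fun e => IW W e) := Finset.mem_filter.2 ⟨he, hW⟩
    simp only [φ, hm, dif_pos]
    exact Finset.mem_filter.1 (g ⟨e, hm⟩).2
  have hφout : ∀ e, ¬ IW W e → φ e = e := by
    intro e hW
    have hm : e ∉ E.filter (fun e => IW W e) := fun h => hW (Finset.mem_filter.1 h).2
    simp only [φ, hm, dif_neg, not_false_eq_true]
  have hφinj : Set.InjOn φ E := by
    intro x hx y hy hxy
    by_cases hxW : IW W x <;> by_cases hyW : IW W y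
    · have hmx : x ∈ E.filter (fun e => IW W e) := Finset.mem_filter.2 ⟨hx, hxW⟩
      have hmy : y ∈ E.filter (fun e => IW W e) := Finset.mem_filter.2 ⟨hy, hyW⟩
      simp only [φ, hmx, hmy, dif_pos] at hxy
      have := g.injective (Subtype.ext hxy)
      exact congrArg Subtype.val this
    · have := (hφin x hx hxW).2
      rw [hxy, hφout y hyW] at this
      exact absurd this hyW
    · have := (hφin y hy hyW).2
      rw [← hxy, hφout x hxW] at this
      exact absurd this hxW
    · rwa [hφout x hxW, hφout y hyW] at hxy
  have hφmaps : ∀ e ∈ E, φ e ∈ E' := by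
    intro e he
    by_cases hW : IW W e
    · exact (hφin e he hW).1
    · rw [hφout e hW]; exact (hout e hW).1 he
  have himgout : ∀ F ⊆ E, (F.image φ).filter (fun e => ¬ IW W e) =
      F.filter (fun e => ¬ IW W e) := by
    intro F hF
    ext e
    simp only [Finset.mem_filter, Finset.mem_image]
    constructor
    · rintro ⟨⟨e', he', rfl⟩, hW⟩
      by_cases hW' : IW W e'
      · exact absurd (hφin e' (hF he') hW').2 hW
      · rw [hφout e' hW'] at hW ⊢; exact ⟨he', hW⟩
    · rintro ⟨he, hW⟩
      exact ⟨⟨e, he, hφout e hW⟩, hW⟩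
  have hOC : ∀ F : Finset (Sym2 V), (∀ a ∈ W, ∀ b ∈ W, cn a b (F.filter (fun e => ¬ IW W e))) →
      cn s t F → cn s t (F.filter (fun e => ¬ IW W e)) := by
    intro F hoc hc
    refine cn_closed hc {x | cn s x (F.filter (fun e => ¬ IW W e))} (cn_refl _ _) ?_
    intro a b hab hsa
    by_cases hW : IW W s(a, b)
    · rw [IW_mk] at hW
      exact cn_trans hsa (hoc a hW.1 b hW.2)
    · exact cn_trans hsa (cn_edge (Finset.mem_filter.2 ⟨hab, hW⟩))
  -- the witness
  let B : Sym2 V → Prop := fun e => ∃ a ∈ e, ∃ b ∈ e, (a = s ∨ a = u) ∧ ¬ (b = s ∨ b = u)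
  let F₀ := E.filter (fun e => ¬ B e)
  have hF₀E : F₀ ⊆ E := Finset.filter_subset _ _
  have hF₀closed : ∀ a b, s(a, b) ∈ F₀ → a ∈ ({s, u} : Set V) → b ∈ ({s, u} : Set V) := by
    intro a b hab ha
    by_contra hb
    exact (Finset.mem_filter.1 hab).2 ⟨a, by simp, b, by simp, by simpa using ha, by simpa using hb⟩
  have hut : u ≠ t := fun h => htW (h ▸ hu)
  have hus : u ≠ s := fun h => hsW (h ▸ hu)
  have hF₀n : ¬ cn s t F₀ := by
    intro h
    have := cn_closed h {s, u} (by simp) hF₀closed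
    simp only [Set.mem_insert_iff, Set.mem_singleton_iff] at this
    rcases this with h | h
    · exact hst h.symm
    · exact hut h.symm
  have hF₀oc : ¬ cn u w₀ (F₀.filter (fun e => ¬ IW W e)) := by
    intro h
    have := cn_closed (cn_mono (Finset.filter_subset _ _) h) {s, u} (by simp) hF₀closed
    simp only [Set.mem_insert_iff, Set.mem_singleton_iff] at this
    rcases this with h | h
    · exact hsW (h ▸ hw₀)
    · exact hne h
  have hF₀c : (E \ F₀).card + 3 ≤ Fintype.card V + R.card := by
    have hsub : E \ F₀ ⊆ ((Finset.univ.erase s).erase u).image (fun v => s(s, v)) ∪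
        (R.erase s).image (fun z => s(u, z)) := by
      intro e he
      rw [Finset.mem_sdiff] at he
      have hB : B e := by
        by_contra hB
        exact he.2 (Finset.mem_filter.2 ⟨he.1, hB⟩)
      obtain ⟨a, ha, b, hb, hab, hb'⟩ := hB
      have hne : a ≠ b := fun h => hb' (h ▸ hab)
      have heq : e = s(a, b) := (Sym2.mem_and_mem_iff hne).1 ⟨ha, hb⟩
      push Not at hb'
      rw [Finset.mem_union, Finset.mem_image, Finset.mem_image]
      rcases hab with rfl | rfl
      · left; exact ⟨b, by simp [hb'], heq.symm⟩
      · right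
        refine ⟨b, ?_, heq.symm⟩
        rw [Finset.mem_erase]
        refine ⟨hb'.1, ?_⟩
        have hE := he.1
        rw [heq] at hE
        by_contra hbR
        have hbW : b ∉ W := fun h => hiso b h hE
        exact hR' b hbR hbW a hu (by rw [Sym2.eq_swap]; exact hE)
    have h1 := (Finset.card_le_card hsub).trans (Finset.card_union_le _ _)
    have h2 := Finset.card_image_le (s := (Finset.univ.erase s).erase u) (f := fun v => s(s, v))
    have h3 := Finset.card_image_le (s := R.erase s) (f := fun z => s(u, z))
    rw [Finset.card_erase_of_mem hsR] at h3
    rw [Finset.card_erase_of_mem (by simp [hus]), Finset.card_erase_of_mem (Finset.mem_univ _),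
      Finset.card_univ] at h2
    have h4 : 1 ≤ R.card := Finset.card_pos.2 ⟨s, hsR⟩
    have h5 : 2 ≤ Fintype.card V := by
      have := Finset.card_le_card (Finset.subset_univ ({s, u} : Finset V))
      rwa [Finset.card_pair hus.symm, Finset.card_univ] at this
    omega
  have hEF₀ := Finset.card_sdiff_add_card_eq_card hF₀E
  -- outer connectedness for E'
  have hlb : ∀ F ⊆ E, F.card = F₀.card → ¬ cn s t (F.image φ) →
      ∀ a ∈ W, ∀ b ∈ W, cn a b (F.filter (fun e => ¬ IW W e)) := by
    intro F hF hFc hn a ha b hb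
    by_contra hab
    have hsub : F.image φ ⊆ E' := by
      intro e he
      obtain ⟨e', he', rfl⟩ := Finset.mem_image.1 he
      exact hφmaps _ (hF he')
    have hic : (F.image φ).card = F.card :=
      Finset.card_image_of_injOn (hφinj.mono (by exact_mod_cast hF))
    have houtE : ∀ z, z ∉ W → ∀ w, s(z, w) ∈ E → s(z, w) ∈ E' := by
      intro z hz w h
      exact (hout _ (by rw [IW_mk]; exact fun h => hz h.1)).1 h
    have := lb s t hst E' (F.image φ) W R hsR htR hRW (fun v hv => houtE s hsW v (hs v hv))
      (fun v hv => houtE t htW v (ht v hv)) (fun z hz w hw => houtE z (hRW z hz) w (hR z hz w hw))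
      v₁ hv₁ hd hn a b ha hb (by rw [himgout F hF]; exact hab)
    have h2 := Finset.card_sdiff_add_card_eq_card hsub
    omega
  refine ⟨F₀.card, NF_lt s t s t E E' φ hφinj hφmaps _ ?_ F₀ hF₀E rfl hF₀n ?_⟩
  · intro F hF hFc hc
    by_contra hn
    have hoc := hlb F hF hFc hn
    have := hOC F hoc hc
    rw [← himgout F hF] at this
    exact hn (cn_mono (Finset.filter_subset _ _) this)
  · by_contra hn
    exact hF₀oc (hlb F₀ hF₀E rfl hn u hu w₀ hw₀)

theorem iso_or_dom {V : Type} (A : SimpleGraph V) (s t : V) (d : V → ℕ)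
    (hd : ∀ u v b, u ≠ s → u ≠ t → v ≠ s → v ≠ t → b ≠ s → b ≠ t → u ≠ b → A.Adj v b →
      ¬ A.Adj u b → d u < d v) (W : Finset V) (hW : W.Nonempty) (hs : s ∉ W) (ht : t ∉ W) :
    (∃ v ∈ W, ∀ w ∈ W, w ≠ v → A.Adj v w) ∨ (∃ u ∈ W, ∀ w ∈ W, ¬ A.Adj u w) := by
  have hsne : ∀ x ∈ W, x ≠ s := fun x hx h => hs (h ▸ hx)
  have htne : ∀ x ∈ W, x ≠ t := fun x hx h => ht (h ▸ hx)
  obtain ⟨v, hv, hmax⟩ := Finset.exists_max_image W d hW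
  by_cases hdom : ∀ w ∈ W, w ≠ v → A.Adj v w
  · exact Or.inl ⟨v, hv, hdom⟩
  · push Not at hdom
    obtain ⟨b, hb, hbv, hadj⟩ := hdom
    refine Or.inr ⟨b, hb, fun x hx hbx => ?_⟩
    have := hd v x b (hsne v hv) (htne v hv) (hsne x hx) (htne x hx) (hsne b hb) (htne b hb)
      hbv.symm hbx.symm hadj
    have := hmax x hx
    omega

theorem mixed {n m : ℕ} {G H : TwoTerminalGraph n} (hG : IsLMRTTG n m G) (hH : IsLMRTTG n m H)
    (hs : H.s = G.s) (ht : H.t = G.t)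
    (hds : ∀ v, v ≠ G.s → G.graph.Adj G.s v) (hdt : ∀ v, v ≠ G.t → G.graph.Adj G.t v)
    (W : Finset (Fin n)) (hsW : G.s ∉ W) (htW : G.t ∉ W)
    (hom : ∀ z, z ∉ W → (∀ w ∈ W, G.graph.Adj z w) ∨ (∀ w ∈ W, ¬ G.graph.Adj z w))
    (hag : ∀ a b, ¬ (a ∈ W ∧ b ∈ W) → (G.graph.Adj a b ↔ H.graph.Adj a b))
    (hcard : 2 ≤ W.card)
    (u : Fin n) (hu : u ∈ W) (hiso : ∀ w ∈ W, ¬ G.graph.Adj u w)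
    (v : Fin n) (hv : v ∈ W) (hdom : ∀ w ∈ W, w ≠ v → H.graph.Adj v w) : False := by
  classical
  obtain ⟨w₀, hw₀, hne⟩ := Finset.exists_mem_ne (by omega : 1 < W.card) u
  obtain ⟨i, hi⟩ := key G.s G.t G.hst (EF G) (EF H)
    (by
      have h1 : edgeCount G.graph = m := hG.1
      have h2 : edgeCount H.graph = m := hH.1
      rw [card_EF, card_EF, h1, h2])
    W (Finset.univ.filter (fun z => z ∉ W ∧ ∀ w ∈ W, G.graph.Adj z w))
    (by
      simp only [Finset.mem_filter, Finset.mem_univ, true_and]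
      exact ⟨hsW, fun w hw => hds w (fun h => hsW (h ▸ hw))⟩)
    (by
      simp only [Finset.mem_filter, Finset.mem_univ, true_and]
      exact ⟨htW, fun w hw => hdt w (fun h => htW (h ▸ hw))⟩)
    (by
      intro z hz
      simp only [Finset.mem_filter, Finset.mem_univ, true_and] at hz
      exact hz.1)
    (fun v hv => (mem_EF _ _ _).2 (hds v hv)) (fun v hv => (mem_EF _ _ _).2 (hdt v hv))
    (by
      intro z hz w hw
      simp only [Finset.mem_filter, Finset.mem_univ, true_and] at hz
      exact (mem_EF _ _ _).2 (hz.2 w hw))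
    (by
      intro z hz hzW w hw
      simp only [Finset.mem_filter, Finset.mem_univ, true_and, not_and] at hz
      rw [mem_EF]
      rcases hom z hzW with h | h
      · exact absurd h (hz hzW)
      · exact h w hw)
    (by
      intro e he
      induction e with | _ a b =>
      rw [IW_mk] at he
      rw [mem_EF, mem_EF]
      exact hag a b he)
    u hu (fun w hw => by rw [mem_EF]; exact hiso w hw) w₀ hw₀ hne
    v hv (fun w hw h => (mem_EF _ _ _).2 (hdom w hw h))
  have heq := opt_eq hG hH i
  rw [Ncoeff_eq, Ncoeff_eq, hs, ht] at heq
  omega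

theorem relabel_one {n : ℕ} (G : TwoTerminalGraph n) : relabel 1 G = G := rfl

theorem peel {n : ℕ} {G H : TwoTerminalGraph n} 
    (W : Finset (Fin n)) 
    (hom : ∀ z, z ∉ W → (∀ w ∈ W, G.graph.Adj z w) ∨ (∀ w ∈ W, ¬ G.graph.Adj z w))
    (hag : ∀ a b, ¬ (a ∈ W ∧ b ∈ W) → (G.graph.Adj a b ↔ H.graph.Adj a b))
    (u : Fin n) (hu : u ∈ W) (u' : Fin n) (hu' : u' ∈ W)
    (P : Prop) (hP : ∀ w ∈ W, w ≠ u → (G.graph.Adj u w ↔ P))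
    (hP' : ∀ w ∈ W, w ≠ u' → (H.graph.Adj u' w ↔ P)) :
    ∀ a b, ¬ (a ∈ W.erase u ∧ b ∈ W.erase u) →
      (G.graph.Adj a b ↔ (relabel (Equiv.swap u u') H).graph.Adj a b) := by
  have hσW : ∀ x, x ∈ W → Equiv.swap u u' x ∈ W := by
    intro x hx
    rw [Equiv.swap_apply_def]
    split_ifs <;> assumption
  have hσn : ∀ x, x ∉ W → Equiv.swap u u' x = x := by
    intro x hx
    exact Equiv.swap_apply_of_ne_of_ne (fun h => hx (h ▸ hu)) (fun h => hx (h ▸ hu'))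
  have hadj : ∀ a b, (relabel (Equiv.swap u u') H).graph.Adj a b ↔
      H.graph.Adj (Equiv.swap u u' a) (Equiv.swap u u' b) := by
    intro a b
    simp [relabel]
  have hhom : ∀ z, z ∉ W → ∀ x ∈ W, ∀ y ∈ W, G.graph.Adj z x → G.graph.Adj z y := by
    intro z hz x hx y hy h
    rcases hom z hz with h1 | h1
    · exact h1 y hy
    · exact absurd h (h1 x hx)
  have hone : ∀ a b, a ∉ W → (G.graph.Adj a b ↔ 
      H.graph.Adj (Equiv.swap u u' a) (Equiv.swap u u' b)) := by
    intro a b ha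
    rw [hσn a ha]
    by_cases hb : b ∈ W
    · rw [← hag a _ (fun h => ha h.1)]
      exact ⟨hhom a ha b hb _ (hσW b hb), hhom a ha _ (hσW b hb) b hb⟩
    · rw [hσn b hb]; exact hag a b (fun h => ha h.1)
  have hu1 : ∀ b, G.graph.Adj u b ↔ 
      H.graph.Adj (Equiv.swap u u' u) (Equiv.swap u u' b) := by
    intro b
    by_cases hb : b ∈ W
    · by_cases hbu : b = u
      · subst hbu; simp
      · rw [hP b hb hbu, Equiv.swap_apply_left, hP' _ (hσW b hb)]
        intro h
        apply hbu
        have h2 : Equiv.swap u u' b = Equiv.swap u u' u := by rw [h, Equiv.swap_apply_left]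
        exact (Equiv.swap u u').injective h2
    · rw [SimpleGraph.adj_comm, hone b u hb, SimpleGraph.adj_comm]
  intro a b hab
  rw [hadj]
  by_cases ha : a ∈ W
  · by_cases hb : b ∈ W
    · by_cases hau : a = u
      · subst hau; exact hu1 b
      · have hbu : b = u := by
          by_contra hbu
          exact hab ⟨Finset.mem_erase.2 ⟨hau, ha⟩, Finset.mem_erase.2 ⟨hbu, hb⟩⟩
        subst hbu
        rw [SimpleGraph.adj_comm, hu1 a, SimpleGraph.adj_comm]
    · rw [SimpleGraph.adj_comm, hone b a hb, SimpleGraph.adj_comm]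
  · exact hone a b ha

theorem uniqA {n m : ℕ} 
    (hthr : ∀ G : TwoTerminalGraph n, IsLMRTTG n m G → ∃ d : Fin n → ℕ, ∀ u v b, u ≠ G.s → u ≠ G.t →
      v ≠ G.s → v ≠ G.t → b ≠ G.s → b ≠ G.t → u ≠ b → G.graph.Adj v b →
      ¬ G.graph.Adj u b → d u < d v)
    (hDs : ∀ G : TwoTerminalGraph n, IsLMRTTG n m G → ∀ v, v ≠ G.s → G.graph.Adj G.s v)
    (hDt : ∀ G : TwoTerminalGraph n, IsLMRTTG n m G → ∀ v, v ≠ G.t → G.graph.Adj G.t v)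
    (G : TwoTerminalGraph n) (hG : IsLMRTTG n m G) :
    ∀ (k : ℕ) (H : TwoTerminalGraph n) (_ : IsLMRTTG n m H)
    (_ : H.s = G.s) (_ : H.t = G.t)
    (W : Finset (Fin n)) (_ : W.card = k) (_ : G.s ∉ W) (_ : G.t ∉ W)
    (_ : ∀ z, z ∉ W → (∀ w ∈ W, G.graph.Adj z w) ∨ (∀ w ∈ W, ¬ G.graph.Adj z w))
    (_ : ∀ a b, ¬ (a ∈ W ∧ b ∈ W) → (G.graph.Adj a b ↔ H.graph.Adj a b)),
    ∃ σ, relabel σ H = G := by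
  intro k
  induction k with
  | zero =>
    intro H hH hs ht W hk hsW htW hom hag
    refine ⟨1, ?_⟩
    rw [relabel_one]
    refine ttg_ext hs ht (fun a b => ?_)
    rw [Finset.card_eq_zero] at hk
    subst hk
    exact (hag a b (by simp)).symm
  | succ k ih =>
    intro H hH hs ht W hk hsW htW hom hag
    have hWne : W.Nonempty := Finset.card_pos.1 (by omega)
    by_cases hk1 : W.card = 1
    · refine ⟨1, ?_⟩
      rw [relabel_one]
      refine ttg_ext hs ht (fun a b => ?_)
      obtain ⟨x, rfl⟩ := Finset.card_eq_one.1 hk1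
      by_cases hab : a ∈ ({x} : Finset (Fin n)) ∧ b ∈ ({x} : Finset (Fin n))
      · simp only [Finset.mem_singleton] at hab
        rw [hab.1, hab.2]; simp
      · exact (hag a b hab).symm
    have hk2 : 2 ≤ W.card := by omega
    obtain ⟨d, hd⟩ := hthr G hG
    obtain ⟨d', hd'⟩ := hthr H hH
    have hsW' : H.s ∉ W := hs ▸ hsW
    have htW' : H.t ∉ W := ht ▸ htW
    have hcases := iso_or_dom G.graph G.s G.t d hd W hWne hsW htW
    have hcases' := iso_or_dom H.graph H.s H.t d' hd' W hWne hsW' htW'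
    have hom' : ∀ z, z ∉ W → (∀ w ∈ W, H.graph.Adj z w) ∨ (∀ w ∈ W, ¬ H.graph.Adj z w) := by
      intro z hz
      rcases hom z hz with h | h
      · left; intro w hw; exact (hag z w (fun h => hz h.1)).1 (h w hw)
      · right; intro w hw h'; exact h w hw ((hag z w (fun h => hz h.1)).2 h')
    have finish : ∀ (u : Fin n) (_ : u ∈ W) (u' : Fin n) (_ : u' ∈ W) (P : Prop) 
        (_ : ∀ w ∈ W, w ≠ u → (G.graph.Adj u w ↔ P))
        (_ : ∀ w ∈ W, w ≠ u' → (H.graph.Adj u' w ↔ P)), ∃ σ, relabel σ H = G := by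
      intro u hu u' hu' P hP hP'
      have hfix : ∀ x, x ∉ W → Equiv.swap u u' x = x := by
        intro x hx
        exact Equiv.swap_apply_of_ne_of_ne (fun h => hx (h ▸ hu)) (fun h => hx (h ▸ hu'))
      obtain ⟨σ, hσ⟩ := ih (relabel (Equiv.swap u u') H) (opt_relabel _ hH)
        (by change Equiv.swap u u' H.s = G.s; rw [hfix _ hsW', hs])
        (by change Equiv.swap u u' H.t = G.t; rw [hfix _ htW', ht])
        (W.erase u) (by rw [Finset.card_erase_of_mem hu]; omega)
        (fun h => hsW (Finset.mem_of_mem_erase h)) (fun h => htW (Finset.mem_of_mem_erase h))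
        (by
          intro z hz
          by_cases hzu : z = u
          · subst hzu
            by_cases hp : P
            · left; intro w hw; rw [Finset.mem_erase] at hw
              exact (hP w hw.2 hw.1).2 hp
            · right; intro w hw; rw [Finset.mem_erase] at hw
              exact fun h => hp ((hP w hw.2 hw.1).1 h)
          · have hzW : z ∉ W := fun h => hz (Finset.mem_erase.2 ⟨hzu, h⟩)
            rcases hom z hzW with h | h
            · left; intro w hw; exact h w (Finset.mem_of_mem_erase hw)
            · right; intro w hw; exact h w (Finset.mem_of_mem_erase hw))
        (peel W hom hag u hu u' hu' P hP hP')
      exact ⟨σ * Equiv.swap u u', by rw [← relabel_relabel]; exact hσ⟩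
    rcases hcases with ⟨v, hv, hvd⟩ | ⟨u, hu, hui⟩ <;> 
      rcases hcases' with ⟨v', hv', hvd'⟩ | ⟨u', hu', hui'⟩
    · exact finish v hv v' hv' True (fun w hw h => by simp [hvd w hw h])
        (fun w hw h => by simp [hvd' w hw h])
    · exact (mixed hH hG hs.symm ht.symm (hDs H hH) (hDt H hH) W hsW' htW' hom'
        (fun a b hab => (hag a b hab).symm) hk2 u' hu' hui' v hv hvd).elim
    · exact (mixed hG hH hs ht (hDs G hG) (hDt G hG) W hsW htW hom hag hk2 u hu hui v' hv' hvd').elim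
    · exact finish u hu u' hu' False (fun w hw h => by simp [hui w hw])
        (fun w hw h => by simp [hui' w hw])

theorem cn_first {V : Type} {s t : V} (hst : s ≠ t) {F : Finset (Sym2 V)} (h : cn s t F) :
    ∃ v, v ≠ s ∧ s(s, v) ∈ F := by
  by_contra hcon
  push Not at hcon
  have := cn_closed h {s} rfl (by
    intro a b hab ha
    have ha : a = s := ha
    subst ha
    by_contra hb
    exact hcon b hb hab)
  exact hst this.symm

open Classical in
theorem cn_two {V : Type} {s t : V} (hst : s ≠ t) {F : Finset (Sym2 V)} (h : cn s t F)
    (hF : F.card ≤ 2) : s(s, t) ∈ F ∨ ∃ v, v ≠ s ∧ v ≠ t ∧ F = {s(s, v), s(t, v)} := by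
  by_cases hmem : s(s, t) ∈ F
  · exact Or.inl hmem
  right
  obtain ⟨v, hvs, hv⟩ := cn_first hst h
  obtain ⟨w, hwt, hw⟩ := cn_first hst.symm (cn_symm h)
  have hvt : v ≠ t := fun h => hmem (h ▸ hv)
  have hws : w ≠ s := fun h => hmem (by rw [Sym2.eq_swap]; exact h ▸ hw)
  have hsub : ({s(s, v), s(t, w)} : Finset (Sym2 V)) ⊆ F := by
    intro e he
    simp only [Finset.mem_insert, Finset.mem_singleton] at he
    rcases he with rfl | rfl <;> assumption
  have hne : s(s, v) ≠ s(t, w) := by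
    intro h
    rw [Sym2.eq_iff] at h
    grind
  have hFeq : F = {s(s, v), s(t, w)} := by
    symm
    apply Finset.eq_of_subset_of_card_le hsub
    rw [Finset.card_pair hne]; exact hF
  refine ⟨v, hvs, hvt, ?_⟩
  by_cases hvw : v = w
  · subst hvw; exact hFeq
  exfalso
  have := cn_closed h {s, v} (by simp) (by
    intro a b hab ha
    rw [hFeq] at hab
    simp only [Finset.mem_insert, Finset.mem_singleton, Sym2.eq_iff] at hab
    simp only [Set.mem_insert_iff, Set.mem_singleton_iff] at ha ⊢
    grind)
  simp only [Set.mem_insert_iff, Set.mem_singleton_iff] at this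
  grind

theorem cn_one {V : Type} {s t : V} (hst : s ≠ t) {F : Finset (Sym2 V)} (h : cn s t F)
    (hF : F.card ≤ 1) : s(s, t) ∈ F := by
  classical
  rcases cn_two hst h (by omega) with h1 | ⟨v, hvs, hvt, rfl⟩
  · exact h1
  · rw [Finset.card_pair (by intro h; rw [Sym2.eq_iff] at h; grind)] at hF
    omega

open Classical in
noncomputable def CNf {V : Type} [Fintype V] (s t : V) (E : Finset (Sym2 V)) : Finset V :=
  Finset.univ.filter (fun v => v ≠ s ∧ v ≠ t ∧ s(s, v) ∈ E ∧ s(t, v) ∈ E)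

theorem NF_one {V : Type} {s t : V} (hst : s ≠ t) (E : Finset (Sym2 V)) (h : s(s, t) ∈ E) :
    NF s t E 1 = 1 := by
  classical
  unfold NF
  rw [Finset.card_eq_one]
  refine ⟨{s(s, t)}, ?_⟩
  ext F
  rw [Finset.mem_filter, Finset.mem_powersetCard, Finset.mem_singleton]
  constructor
  · rintro ⟨⟨h1, h2⟩, h3⟩
    have := cn_one hst h3 h2.le
    obtain ⟨e, rfl⟩ := Finset.card_eq_one.1 h2
    rw [Finset.mem_singleton] at this
    rw [this]
  · rintro rfl
    exact ⟨⟨by simpa using h, by simp⟩, cn_edge (by simp)⟩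

theorem NF_one_pos {V : Type} {s t : V} (hst : s ≠ t) (E : Finset (Sym2 V)) (h : NF s t E 1 ≠ 0) :
    s(s, t) ∈ E := by
  classical
  unfold NF at h
  obtain ⟨F, hF⟩ := Finset.card_pos.1 (Nat.pos_of_ne_zero h)
  rw [Finset.mem_filter, Finset.mem_powersetCard] at hF
  exact hF.1.1 (cn_one hst hF.2 hF.1.2.le)

theorem NF_two {V : Type} [Fintype V] {s t : V} (hst : s ≠ t) (E : Finset (Sym2 V))
    (h : s(s, t) ∈ E) : NF s t E 2 = E.card - 1 + (CNf s t E).card := by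
  classical
  unfold NF
  have hset : (E.powersetCard 2).filter (cn s t) =
      (E.erase s(s, t)).image (fun e => {s(s, t), e}) ∪
      (CNf s t E).image (fun v => {s(s, v), s(t, v)}) := by
    ext F
    rw [Finset.mem_filter, Finset.mem_powersetCard, Finset.mem_union, Finset.mem_image,
      Finset.mem_image]
    constructor
    · rintro ⟨⟨h1, h2⟩, h3⟩
      rcases cn_two hst h3 h2.le with h4 | ⟨v, hvs, hvt, rfl⟩
      · left
        obtain ⟨e, he, hne⟩ := Finset.exists_mem_ne (by omega : 1 < F.card) s(s, t)
        refine ⟨e, Finset.mem_erase.2 ⟨hne, h1 he⟩, ?_⟩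
        apply Finset.eq_of_subset_of_card_le
        · intro x hx
          simp only [Finset.mem_insert, Finset.mem_singleton] at hx
          rcases hx with rfl | rfl <;> assumption
        · rw [Finset.card_pair hne.symm]; omega
      · right
        exact ⟨v, by simp [CNf, hvs, hvt, h1 (Finset.mem_insert_self _ _),
          h1 (Finset.mem_insert_of_mem (Finset.mem_singleton_self _))], rfl⟩
    · rintro (⟨e, he, rfl⟩ | ⟨v, hv, rfl⟩)
      · rw [Finset.mem_erase] at he
        refine ⟨⟨?_, Finset.card_pair he.1.symm⟩, cn_edge (by simp)⟩
        intro x hx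
        simp only [Finset.mem_insert, Finset.mem_singleton] at hx
        rcases hx with rfl | rfl
        · exact h
        · exact he.2
      · simp only [CNf, Finset.mem_filter, Finset.mem_univ, true_and] at hv
        refine ⟨⟨?_, Finset.card_pair ?_⟩, cn_trans (t := v) (cn_edge (by simp))
          (cn_symm (cn_edge (by simp)))⟩
        · intro x hx
          simp only [Finset.mem_insert, Finset.mem_singleton] at hx
          rcases hx with rfl | rfl
          · exact hv.2.2.1
          · exact hv.2.2.2
        · intro h; rw [Sym2.eq_iff] at h; grind
  rw [hset, Finset.card_union_of_disjoint, Finset.card_image_of_injOn,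
    Finset.card_image_of_injOn, Finset.card_erase_of_mem h]
  · intro x hx y hy hxy
    simp only [CNf, Finset.coe_filter, Finset.mem_univ, true_and, Set.mem_ofPred_eq] at hx hy
    have : s(s, x) ∈ ({s(s, y), s(t, y)} : Finset (Sym2 V)) := by
      have h2 : ({s(s, x), s(t, x)} : Finset (Sym2 V)) = {s(s, y), s(t, y)} := hxy
      rw [← h2]; simp
    simp only [Finset.mem_insert, Finset.mem_singleton, Sym2.eq_iff] at this
    grind
  · intro x hx y hy hxy
    simp only [Finset.coe_erase, Set.mem_sdiff, Finset.mem_coe, Set.mem_singleton_iff] at hx hy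
    have : x ∈ ({s(s, t), y} : Finset (Sym2 V)) := by
      have h2 : ({s(s, t), x} : Finset (Sym2 V)) = {s(s, t), y} := hxy
      rw [← h2]; simp
    simp only [Finset.mem_insert, Finset.mem_singleton] at this
    tauto
  · rw [Finset.disjoint_left]
    intro F hF hF'
    obtain ⟨e, he, rfl⟩ := Finset.mem_image.1 hF
    obtain ⟨v, hv, heq⟩ := Finset.mem_image.1 hF'
    simp only [CNf, Finset.mem_filter, Finset.mem_univ, true_and] at hv
    have : s(s, t) ∈ ({s(s, v), s(t, v)} : Finset (Sym2 V)) := by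
      have h2 : ({s(s, v), s(t, v)} : Finset (Sym2 V)) = {s(s, t), e} := heq
      rw [h2]; simp
    simp only [Finset.mem_insert, Finset.mem_singleton, Sym2.eq_iff] at this
    grind

theorem mkG_TT {n m : ℕ} (s t : Fin n) (h : s ≠ t) (E : Finset (Sym2 (Fin n)))
    (hE : ∀ e ∈ E, ¬ e.IsDiag) (hc : E.card = m) : mkG s t h E ∈ TT n m := by
  change edgeCount _ = m
  rw [← card_EF, EF_mkG s t h E hE, hc]

theorem opt_st {n m : ℕ} {G : TwoTerminalGraph n} (hG : IsLMRTTG n m G)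
    (E : Finset (Sym2 (Fin n))) (hE : ∀ e ∈ E, ¬ e.IsDiag) (hc : E.card = m)
    (hst : s(G.s, G.t) ∈ E) :
    s(G.s, G.t) ∈ EF G ∧ (CNf G.s G.t E).card ≤ (CNf G.s G.t (EF G)).card := by
  have hT := mkG_TT G.s G.t G.hst E hE hc
  have hE' := EF_mkG G.s G.t G.hst E hE
  have hN : ∀ i, Ncoeff (mkG G.s G.t G.hst E) i = NF G.s G.t E i := by
    intro i; rw [Ncoeff_eq, hE']; rfl
  have h0 : ∀ j < 1, Ncoeff G j = Ncoeff (mkG G.s G.t G.hst E) j := by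
    intro j hj
    have : j = 0 := by omega
    subst this
    rw [hN, Ncoeff_eq, NF_zero _ _ G.hst, NF_zero _ _ G.hst]
  have h1 := lex_le hG hT h0
  rw [hN, NF_one G.hst E hst, Ncoeff_eq] at h1
  have hmem := NF_one_pos G.hst _ (by omega : NF G.s G.t (EF G) 1 ≠ 0)
  refine ⟨hmem, ?_⟩
  have h2 := lex_le (k := 2) hG hT (by
    intro j hj
    interval_cases j
    · exact h0 0 one_pos
    · rw [hN, NF_one G.hst E hst, Ncoeff_eq, NF_one G.hst _ hmem])
  rw [hN, NF_two G.hst E hst, Ncoeff_eq, NF_two G.hst _ hmem, hc, card_EF] at h2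
  have h3 : edgeCount G.graph = m := hG.1
  rw [h3] at h2
  omega

open Classical in
noncomputable def StarE {V : Type} (s t : V) (C : Finset V) : Finset (Sym2 V) :=
  insert s(s, t) (C.image (fun v => s(s, v)) ∪ C.image (fun v => s(t, v)))

theorem mem_StarE {V : Type} (s t : V) (C : Finset V) (e : Sym2 V) :
    e ∈ StarE s t C ↔ e = s(s, t) ∨ (∃ v ∈ C, e = s(s, v)) ∨ ∃ v ∈ C, e = s(t, v) := by
  unfold StarE
  simp only [Finset.mem_insert, Finset.mem_union, Finset.mem_image, eq_comm]

theorem card_StarE {V : Type} (s t : V) (hst : s ≠ t) (C : Finset V) (hs : s ∉ C) (ht : t ∉ C) :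
    (StarE s t C).card = 2 * C.card + 1 := by
  classical
  unfold StarE
  rw [Finset.card_insert_of_notMem, Finset.card_union_of_disjoint, Finset.card_image_of_injective,
    Finset.card_image_of_injective]
  · ring
  · intro x y h; have h2 := Sym2.eq_iff.1 h; grind
  · intro x y h; have h2 := Sym2.eq_iff.1 h; grind
  · rw [Finset.disjoint_left]
    simp only [Finset.mem_image]
    rintro _ ⟨x, hx, rfl⟩ ⟨y, hy, h⟩
    rw [Sym2.eq_iff] at h
    grind
  · simp only [Finset.mem_union, Finset.mem_image, Sym2.eq_iff]
    grind

theorem StarE_not_diag {V : Type} (s t : V) (hst : s ≠ t) (C : Finset V) (hs : s ∉ C) (ht : t ∉ C) :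
    ∀ e ∈ StarE s t C, ¬ e.IsDiag := by
  intro e he
  rw [mem_StarE] at he
  rcases he with rfl | ⟨v, hv, rfl⟩ | ⟨v, hv, rfl⟩ <;> simp <;> grind

theorem extend_edges {n m : ℕ} (hm : m ≤ n.choose 2) (E : Finset (Sym2 (Fin n)))
    (hE : ∀ e ∈ E, ¬ e.IsDiag) (hc : E.card ≤ m) :
    ∃ E', E ⊆ E' ∧ (∀ e ∈ E', ¬ e.IsDiag) ∧ E'.card = m := by
  classical
  obtain ⟨E', h1, h2, h3⟩ := Finset.exists_subsuperset_card_eq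
    (s := E) (t := (⊤ : SimpleGraph (Fin n)).edgeFinset) (n := m) (by
      intro e he
      have := hE e he
      induction e with | _ a b =>
      simpa using this) hc (by
      rw [SimpleGraph.card_edgeFinset_top_eq_card_choose_two, Fintype.card_fin]; exact hm)
  refine ⟨E', h1, ?_, h3⟩
  intro e he
  have := h2 he
  induction e with | _ a b =>
  simpa using this

theorem opt_basic {n m : ℕ} (hm : m ≤ n.choose 2) {G : TwoTerminalGraph n} (hG : IsLMRTTG n m G)
    (c : ℕ) (hc : c ≤ n - 2) (hcm : 2 * c + 1 ≤ m) :
    s(G.s, G.t) ∈ EF G ∧ c ≤ (CNf G.s G.t (EF G)).card := by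
  classical
  obtain ⟨C, hC, hCc⟩ := Finset.exists_subset_card_eq (s := (Finset.univ.erase G.s).erase G.t)
    (n := c) (by
      rw [Finset.card_erase_of_mem (by simp [G.hst.symm]), Finset.card_erase_of_mem (by simp),
        Finset.card_univ, Fintype.card_fin]; omega)
  have hs : G.s ∉ C := fun h => by simpa using hC h
  have ht : G.t ∉ C := fun h => by simpa using hC h
  obtain ⟨E, hE1, hE2, hE3⟩ := extend_edges hm (StarE G.s G.t C) (StarE_not_diag _ _ G.hst _ hs ht)
    (by rw [card_StarE _ _ G.hst _ hs ht]; omega)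
  obtain ⟨h1, h2⟩ := opt_st hG E hE2 hE3 (hE1 (by simp [mem_StarE]))
  refine ⟨h1, le_trans ?_ h2⟩
  rw [← hCc]
  apply Finset.card_le_card
  intro v hv
  simp only [CNf, Finset.mem_filter, Finset.mem_univ, true_and]
  refine ⟨fun h => hs (h ▸ hv), fun h => ht (h ▸ hv), hE1 ?_, hE1 ?_⟩
  · rw [mem_StarE]; exact Or.inr (Or.inl ⟨v, hv, rfl⟩)
  · rw [mem_StarE]; exact Or.inr (Or.inr ⟨v, hv, rfl⟩)

open Classical in
noncomputable def gs {V : Type} (s t : V) (St : Finset (Sym2 V)) (i : ℕ) (J : Finset (Sym2 V)) :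
    Finset (Finset (Sym2 V)) :=
  St.powerset.filter (fun A => A.card + J.card = i ∧ cn s t (A ∪ J))

open Classical in
theorem NF_sum {V : Type} (s t : V) (St Hs : Finset (Sym2 V)) (hd : Disjoint St Hs) (i : ℕ) :
    NF s t (St ∪ Hs) i = ∑ J ∈ Hs.powerset, (gs s t St i J).card := by
  unfold NF
  rw [Finset.card_eq_sum_card_fiberwise (f := fun F => F ∩ Hs) (t := Hs.powerset)]
  · apply Finset.sum_congr rfl
    intro J hJ
    rw [Finset.mem_powerset] at hJ
    have hdJ : Disjoint St J := Finset.disjoint_of_subset_right hJ hd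
    have : ((((St ∪ Hs).powersetCard i).filter (cn s t)).filter (fun F => F ∩ Hs = J)) =
        (gs s t St i J).image (fun A => A ∪ J) := by
      ext F
      simp only [Finset.mem_filter, Finset.mem_powersetCard, gs, Finset.mem_image,
        Finset.mem_powerset]
      constructor
      · rintro ⟨⟨⟨h1, h2⟩, h3⟩, h4⟩
        have hF : F ∩ St ∪ J = F := by
          rw [← h4, ← Finset.inter_union_distrib_left]
          exact Finset.inter_eq_left.2 h1
        refine ⟨F ∩ St, ⟨Finset.inter_subset_right, ?_, by rw [hF]; exact h3⟩, hF⟩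
        rw [← Finset.card_union_of_disjoint, hF, h2]
        exact Finset.disjoint_of_subset_left Finset.inter_subset_right hdJ
      · rintro ⟨A, ⟨h1, h2, h3⟩, rfl⟩
        have hdA : Disjoint A J := Finset.disjoint_of_subset_left h1 hdJ
        refine ⟨⟨⟨Finset.union_subset_union h1 hJ, ?_⟩, h3⟩, ?_⟩
        · rw [Finset.card_union_of_disjoint hdA, h2]
        · rw [Finset.union_inter_distrib_right, Finset.inter_eq_left.2 hJ,
            Finset.disjoint_iff_inter_eq_empty.1 (Finset.disjoint_of_subset_left h1 hd),
            Finset.empty_union]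
    rw [this, Finset.card_image_of_injOn]
    intro A hA B hB hAB
    simp only [gs, Finset.coe_filter, Finset.mem_powerset, Set.mem_ofPred_eq] at hA hB
    have hA' : (A ∪ J) \ J = A := Finset.union_sdiff_cancel_right
      (Finset.disjoint_of_subset_left hA.1 hdJ)
    have hB' : (B ∪ J) \ J = B := Finset.union_sdiff_cancel_right
      (Finset.disjoint_of_subset_left hB.1 hdJ)
    have hAB : A ∪ J = B ∪ J := hAB
    rw [← hA', hAB, hB']
  · intro F hF
    simp

/-- edges avoid terminals -/
def NT {V : Type} (s t : V) (J : Finset (Sym2 V)) : Prop := ∀ e ∈ J, s ∉ e ∧ t ∉ e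

theorem cn_small {V : Type} {s t : V} (hst : s ≠ t) {A J F : Finset (Sym2 V)} (hJ : NT s t J)
    (hF : ∀ e, e ∈ F ↔ e ∈ A ∨ e ∈ J)
    (hA : A.card ≤ 1) : cn s t F ↔ s(s, t) ∈ A := by
  constructor
  · intro h
    obtain ⟨v, hvs, hv⟩ := cn_first hst h
    obtain ⟨w, hwt, hw⟩ := cn_first hst.symm (cn_symm h)
    rw [hF] at hv hw
    have hv : s(s, v) ∈ A := hv.resolve_right (fun h => (hJ _ h).1 (by simp))
    have hw : s(t, w) ∈ A := hw.resolve_right (fun h => (hJ _ h).2 (by simp))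
    have := Finset.card_le_one.1 hA _ hv _ hw
    rw [Sym2.eq_iff] at this
    have : v = t := by grind
    subst this; exact hv
  · intro h
    exact cn_edge ((hF _).2 (Or.inl h))

open Classical in
theorem gs_small {V : Type} {s t : V} (hst : s ≠ t) (St J J' : Finset (Sym2 V)) (hJ : NT s t J)
    (hJ' : NT s t J') (hc : J.card = J'.card) (i : ℕ) (hi : i ≤ J.card + 1) :
    gs s t St i J = gs s t St i J' := by
  unfold gs
  apply Finset.filter_congr
  intro A hA
  rw [hc]
  refine and_congr_right (fun h => ?_)
  rw [cn_small hst hJ (A := A) (by simp) (by omega), cn_small hst hJ' (A := A) (by simp) (by omega)]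

open Classical in
theorem gs_map_le {V : Type} {s t : V} (St J : Finset (Sym2 V)) (σ : Equiv.Perm V)
    (hs : σ s = s) (ht : σ t = t) (hSt : ∀ e ∈ St, Sym2.map σ e ∈ St) (i : ℕ) :
    (gs s t St i J).card ≤ (gs s t St i (J.image (Sym2.map σ))).card := by
  apply Finset.card_le_card_of_injOn (fun A => A.image (Sym2.map σ))
  · intro A hA
    simp only [gs, Finset.coe_filter, Finset.mem_powerset, Set.mem_ofPred_eq] at hA ⊢
    refine ⟨?_, ?_, ?_⟩
    · intro e he
      obtain ⟨e', he', rfl⟩ := Finset.mem_image.1 he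
      exact hSt _ (hA.1 he')
    · rw [Finset.card_image_of_injective _ (sym2_map_inj σ),
        Finset.card_image_of_injective _ (sym2_map_inj σ)]
      exact hA.2.1
    · rw [← Finset.image_union]
      have := cn_map σ hA.2.2
      rw [hs, ht] at this
      exact this
  · intro A _ B _ h
    exact Finset.image_injective (sym2_map_inj σ) h

open Classical in
theorem map_swap_swap {V : Type} (u v : V) (J : Finset (Sym2 V)) :
    (J.image (Sym2.map (Equiv.swap u v))).image (Sym2.map (Equiv.swap u v)) = J := by
  rw [Finset.image_image, ← Sym2.map_comp]
  have : (⇑(Equiv.swap u v) ∘ ⇑(Equiv.swap u v)) = id := by ext x; simp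
  rw [this, Sym2.map_id, Finset.image_id]

open Classical in
theorem gs_swap {V : Type} {s t : V} (St J : Finset (Sym2 V)) (u v : V)
    (hus : u ≠ s) (hut : u ≠ t) (hvs : v ≠ s) (hvt : v ≠ t)
    (hSt : ∀ e ∈ St, Sym2.map (Equiv.swap u v) e ∈ St) (i : ℕ) :
    (gs s t St i (J.image (Sym2.map (Equiv.swap u v)))).card = (gs s t St i J).card := by
  have hs : Equiv.swap u v s = s := Equiv.swap_apply_of_ne_of_ne hus.symm hvs.symm
  have ht : Equiv.swap u v t = t := Equiv.swap_apply_of_ne_of_ne hut.symm hvt.symm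
  apply le_antisymm
  · have := gs_map_le St (J.image (Sym2.map (Equiv.swap u v))) _ hs ht hSt i
    rwa [map_swap_swap] at this
  · exact gs_map_le St J _ hs ht hSt i

theorem cn_pq {V : Type} {s t p q : V} (hst : s ≠ t) {J F : Finset (Sym2 V)} (hJ : NT s t J)
    (hps : p ≠ s) (hpt : p ≠ t) (hqs : q ≠ s) (hqt : q ≠ t)
    (hF : ∀ e, e ∈ F ↔ e = s(s, p) ∨ e = s(t, q) ∨ e ∈ J) : cn s t F ↔ cn p q J := by
  constructor
  · intro h
    by_contra hcon
    have hT : ¬ cn p t J := by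
      intro h
      have := cn_closed (cn_symm h) {t} rfl (by
        intro a b hab ha
        have ha : a = t := ha
        subst ha
        exact absurd (by simp) (hJ _ hab).2)
      exact hpt this
    have := cn_closed h {z | z = s ∨ cn p z J} (Or.inl rfl) (by
      intro a b hab ha
      rw [hF] at hab
      rcases hab with hab | hab | hab
      · rw [Sym2.eq_iff] at hab
        rcases hab with ⟨rfl, rfl⟩ | ⟨rfl, rfl⟩
        · exact Or.inr (cn_refl _ _)
        · exact Or.inl rfl
      · rw [Sym2.eq_iff] at hab
        exfalso
        rcases hab with ⟨rfl, rfl⟩ | ⟨rfl, rfl⟩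
        · rcases ha with h | h
          · exact hst h.symm
          · exact hT h
        · rcases ha with h | h
          · exact hqs h
          · exact hcon h
      · rcases ha with rfl | h
        · exact absurd (by simp) (hJ _ hab).1
        · exact Or.inr (cn_trans h (cn_edge hab)))
    rcases this with h | h
    · exact hst h.symm
    · exact hT h
  · intro h
    refine cn_trans (cn_edge ((hF _).2 (Or.inl rfl))) (cn_trans (cn_mono ?_ h)
      (cn_symm (cn_edge ((hF _).2 (Or.inr (Or.inl rfl))))))
    intro e he
    exact (hF _).2 (Or.inr (Or.inr he))

open Classical in
theorem gs_four {V : Type} {s t : V} (hst : s ≠ t) (W : Finset V) (hs : s ∉ W) (ht : t ∉ W)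
    (J : Finset (Sym2 V)) (hJ : NT s t J) (hc : J.card = 2) :
    (gs s t (StarE s t W) 4 J).card =
      (((StarE s t W).powersetCard 2).filter (fun A => s(s, t) ∈ A)).card +
      ((W ×ˢ W).filter (fun x => cn x.1 x.2 J)).card := by
  have hset : gs s t (StarE s t W) 4 J =
      (((StarE s t W).powersetCard 2).filter (fun A => s(s, t) ∈ A)) ∪
      ((W ×ˢ W).filter (fun x => cn x.1 x.2 J)).image (fun x => {s(s, x.1), s(t, x.2)}) := by
    ext A
    simp only [gs, Finset.mem_filter, Finset.mem_powerset, Finset.mem_union,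
      Finset.mem_powersetCard, Finset.mem_image, Finset.mem_product, Prod.exists, hc]
    constructor
    · rintro ⟨h1, h2, h3⟩
      by_cases hmem : s(s, t) ∈ A
      · left; exact ⟨⟨h1, by omega⟩, hmem⟩
      right
      obtain ⟨p, hps, hp⟩ := cn_first hst h3
      obtain ⟨q, hqt, hq⟩ := cn_first hst.symm (cn_symm h3)
      rw [Finset.mem_union] at hp hq
      have hp : s(s, p) ∈ A := hp.resolve_right (fun h => (hJ _ h).1 (by simp))
      have hq : s(t, q) ∈ A := hq.resolve_right (fun h => (hJ _ h).2 (by simp))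
      have hpt : p ≠ t := fun h => hmem (h ▸ hp)
      have hqs : q ≠ s := fun h => hmem (by rw [Sym2.eq_swap]; exact h ▸ hq)
      have hsub : ({s(s, p), s(t, q)} : Finset (Sym2 V)) ⊆ A := by
        intro e he
        simp only [Finset.mem_insert, Finset.mem_singleton] at he
        rcases he with rfl | rfl <;> assumption
      have hne : s(s, p) ≠ s(t, q) := by
        intro h
        rw [Sym2.eq_iff] at h
        grind
      have hFeq : {s(s, p), s(t, q)} = A := by
        apply Finset.eq_of_subset_of_card_le hsub
        rw [Finset.card_pair hne]; omega
      have hpW : p ∈ W := by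
        have := h1 hp
        rw [mem_StarE] at this
        simp only [Sym2.eq_iff] at this
        grind
      have hqW : q ∈ W := by
        have := h1 hq
        rw [mem_StarE] at this
        simp only [Sym2.eq_iff] at this
        grind
      refine ⟨p, q, ⟨⟨hpW, hqW⟩, ?_⟩, hFeq⟩
      rw [← cn_pq hst hJ hps hpt hqs hqt (F := A ∪ J)]
      · exact h3
      · intro e
        rw [← hFeq]; simp
    · rintro (⟨⟨h1, h2⟩, h3⟩ | ⟨p, q, ⟨⟨hp, hq⟩, h⟩, rfl⟩)
      · exact ⟨h1, by omega, cn_edge (by simp [h3])⟩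
      · have hps : p ≠ s := fun h => hs (h ▸ hp)
        have hpt : p ≠ t := fun h => ht (h ▸ hp)
        have hqs : q ≠ s := fun h => hs (h ▸ hq)
        have hqt : q ≠ t := fun h => ht (h ▸ hq)
        refine ⟨?_, ?_, ?_⟩
        · intro e he
          simp only [Finset.mem_insert, Finset.mem_singleton] at he
          rw [mem_StarE]
          rcases he with rfl | rfl
          · exact Or.inr (Or.inl ⟨p, hp, rfl⟩)
          · exact Or.inr (Or.inr ⟨q, hq, rfl⟩)
        · rw [Finset.card_pair]
          intro h
          rw [Sym2.eq_iff] at h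
          grind
        · rw [cn_pq hst hJ hps hpt hqs hqt]
          · exact h
          · intro e; simp
  rw [hset, Finset.card_union_of_disjoint, Finset.card_image_of_injOn]
  · rintro ⟨p, q⟩ h1 ⟨p', q'⟩ h2 heq
    simp only [Finset.coe_filter, Finset.mem_product, Set.mem_ofPred_eq] at h1 h2
    have heq : ({s(s, p), s(t, q)} : Finset (Sym2 V)) = {s(s, p'), s(t, q')} := heq
    have h3 : s(s, p) ∈ ({s(s, p'), s(t, q')} : Finset (Sym2 V)) := by rw [← heq]; simp
    have h4 : s(t, q) ∈ ({s(s, p'), s(t, q')} : Finset (Sym2 V)) := by rw [← heq]; simp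
    simp only [Finset.mem_insert, Finset.mem_singleton, Sym2.eq_iff] at h3 h4
    have : p = p' := by grind
    have : q = q' := by grind
    simp_all
  · rw [Finset.disjoint_left]
    intro A hA hA'
    obtain ⟨⟨p, q⟩, h1, rfl⟩ := Finset.mem_image.1 hA'
    simp only [Finset.mem_filter, Finset.mem_product] at h1
    have h3 := (Finset.mem_filter.1 hA).2
    simp only [Finset.mem_insert, Finset.mem_singleton, Sym2.eq_iff] at h3
    grind

open Classical in
theorem reach_path {V : Type} (W : Finset V) (u b x : V) (hu : u ∈ W) (hb : b ∈ W) (hx : x ∈ W)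
    (hub : u ≠ b) (hux : u ≠ x) (hbx : b ≠ x) :
    ((W ×ˢ W).filter (fun y => cn y.1 y.2 {s(u, b), s(u, x)})).card = W.card + 6 := by
  have : (W ×ˢ W).filter (fun y => cn y.1 y.2 {s(u, b), s(u, x)}) =
      W.diag ∪ ({u, b, x} : Finset V).offDiag := by
    ext ⟨p, q⟩
    simp only [Finset.mem_filter, Finset.mem_product, Finset.mem_union, Finset.mem_diag,
      Finset.mem_offDiag, Finset.mem_insert, Finset.mem_singleton]
    constructor
    · rintro ⟨⟨hp, hq⟩, h⟩
      by_cases hpq : p = q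
      · exact Or.inl ⟨hp, hpq⟩
      right
      by_cases hP : p = u ∨ p = b ∨ p = x
      · refine ⟨hP, ?_, hpq⟩
        exact cn_closed h {z | z = u ∨ z = b ∨ z = x} hP (by
          intro a c hac ha
          simp only [Finset.mem_insert, Finset.mem_singleton, Sym2.eq_iff,
            Set.mem_ofPred_eq] at hac ha ⊢
          grind)
      · have := cn_closed h {p} rfl (by
          intro a c hac ha
          simp only [Finset.mem_insert, Finset.mem_singleton, Sym2.eq_iff,
            Set.mem_singleton_iff] at hac ha ⊢
          grind)
        exact absurd this.symm hpq
    · rintro (⟨hp, rfl⟩ | ⟨hp, hq, hpq⟩)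
      · exact ⟨⟨hp, hp⟩, cn_refl _ _⟩
      · have key : ∀ z, z = u ∨ z = b ∨ z = x → cn u z {s(u, b), s(u, x)} := by
          rintro z (rfl | rfl | rfl)
          · exact cn_refl _ _
          · exact cn_edge (by simp)
          · exact cn_edge (by simp)
        refine ⟨by grind, cn_trans (cn_symm (key p hp)) (key q hq)⟩
  rw [this, Finset.card_union_of_disjoint, Finset.diag_card, Finset.offDiag_card]
  · have : ({u, b, x} : Finset V).card = 3 := by
      rw [Finset.card_eq_three]; exact ⟨u, b, x, hub, hux, hbx, rfl⟩
    rw [this]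
  · rw [Finset.disjoint_left]
    intro y h1 h2
    simp only [Finset.mem_diag, Finset.mem_offDiag] at h1 h2
    exact h2.2.2 h1.2

open Classical in
theorem reach_two {V : Type} (W : Finset V) (v u b x : V) (hv : v ∈ W) (hu : u ∈ W) (hb : b ∈ W)
    (hx : x ∈ W) (hvb : v ≠ b) (hux : u ≠ x) (hvu : v ≠ u) (hvx : v ≠ x) (hbu : b ≠ u)
    (hbx : b ≠ x) :
    ((W ×ˢ W).filter (fun y => cn y.1 y.2 {s(v, b), s(u, x)})).card = W.card + 4 := by
  have : (W ×ˢ W).filter (fun y => cn y.1 y.2 {s(v, b), s(u, x)}) =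
      W.diag ∪ {(v, b), (b, v), (u, x), (x, u)} := by
    ext ⟨p, q⟩
    simp only [Finset.mem_filter, Finset.mem_product, Finset.mem_union, Finset.mem_diag,
      Finset.mem_insert, Finset.mem_singleton, Prod.mk.injEq]
    constructor
    · rintro ⟨⟨hp, hq⟩, h⟩
      by_cases hpq : p = q
      · exact Or.inl ⟨hp, hpq⟩
      right
      have := cn_closed h {z | z = p ∨ (p = v ∧ z = b) ∨ (p = b ∧ z = v) ∨ (p = u ∧ z = x) ∨
          (p = x ∧ z = u)} (Or.inl rfl) (by
          intro a c hac ha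
          simp only [Finset.mem_insert, Finset.mem_singleton, Sym2.eq_iff,
            Set.mem_ofPred_eq] at hac ha ⊢
          grind)
      simp only [Set.mem_ofPred_eq] at this
      grind
    · rintro (⟨hp, rfl⟩ | ⟨rfl, rfl⟩ | ⟨rfl, rfl⟩ | ⟨rfl, rfl⟩ | ⟨rfl, rfl⟩)
      · exact ⟨⟨hp, hp⟩, cn_refl _ _⟩
      · exact ⟨⟨hv, hb⟩, cn_edge (by simp)⟩
      · exact ⟨⟨hb, hv⟩, cn_symm (cn_edge (by simp))⟩
      · exact ⟨⟨hu, hx⟩, cn_edge (by simp)⟩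
      · exact ⟨⟨hx, hu⟩, cn_symm (cn_edge (by simp))⟩
  rw [this, Finset.card_union_of_disjoint, Finset.diag_card]
  · congr 1
    rw [Finset.card_insert_of_notMem, Finset.card_insert_of_notMem, Finset.card_pair] <;>
    simp <;> grind
  · rw [Finset.disjoint_left]
    rintro ⟨p, q⟩ h1 h2
    simp only [Finset.mem_diag, Finset.mem_insert, Finset.mem_singleton, Prod.mk.injEq] at h1 h2
    grind

open Classical in
theorem StarE_swap {V : Type} {s t : V} (W : Finset V) (hW : ∀ x, x ∈ W ↔ x ≠ s ∧ x ≠ t) (u v : V)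
    (hu : u ∈ W) (hv : v ∈ W) :
    ∀ e ∈ StarE s t W, Sym2.map (Equiv.swap u v) e ∈ StarE s t W := by
  intro e he
  have hs : Equiv.swap u v s = s := Equiv.swap_apply_of_ne_of_ne
    ((hW u).1 hu).1.symm ((hW v).1 hv).1.symm
  have ht : Equiv.swap u v t = t := Equiv.swap_apply_of_ne_of_ne
    ((hW u).1 hu).2.symm ((hW v).1 hv).2.symm
  have hw : ∀ x ∈ W, Equiv.swap u v x ∈ W := by
    intro x hx
    rw [Equiv.swap_apply_def]
    split_ifs <;> assumption
  rw [mem_StarE] at he ⊢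
  rcases he with rfl | ⟨x, hx, rfl⟩ | ⟨x, hx, rfl⟩
  · left; rw [Sym2.map_mk, hs, ht]
  · right; left; exact ⟨_, hw x hx, by rw [Sym2.map_mk, hs]⟩
  · right; right; exact ⟨_, hw x hx, by rw [Sym2.map_mk, ht]⟩

open Classical in
theorem gs_ux {V : Type} {s t : V} (hst : s ≠ t) (W : Finset V)
    (hW : ∀ x, x ∈ W ↔ x ≠ s ∧ x ≠ t) (u v b x : V)
    (hu : u ∈ W) (hv : v ∈ W) (hb : b ∈ W) (hx : x ∈ W) (huv : u ≠ v) (hub : u ≠ b)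
    (hvb : v ≠ b) (hxu : x ≠ u) (hxv : x ≠ v) (hxb : x ≠ b) :
    (gs s t (StarE s t W) 4 {s(u, b), s(u, x)}).card =
      (gs s t (StarE s t W) 4 {s(v, b), s(u, x)}).card + 2 := by
  have hs : s ∉ W := by simp [hW]
  have ht : t ∉ W := by simp [hW]
  have hu' := (hW u).1 hu
  have hv' := (hW v).1 hv
  have hb' := (hW b).1 hb
  have hx' := (hW x).1 hx
  rw [gs_four hst W hs ht, gs_four hst W hs ht, reach_path W u b x hu hb hx hub hxu.symm hxb.symm,
    reach_two W v u b x hv hu hb hx hvb hxu.symm huv.symm hxv.symm hub.symm hxb.symm]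
  · rfl
  · intro e he
    simp only [Finset.mem_insert, Finset.mem_singleton] at he
    rcases he with rfl | rfl <;> simp only [Sym2.mem_iff] <;> grind
  · rw [Finset.card_pair]; intro h; rw [Sym2.eq_iff] at h; grind
  · intro e he
    simp only [Finset.mem_insert, Finset.mem_singleton] at he
    rcases he with rfl | rfl <;> simp only [Sym2.mem_iff] <;> grind
  · rw [Finset.card_pair]; intro h; rw [Sym2.eq_iff] at h; grind

open Classical in
theorem gs_diff {V : Type} {s t : V} (hst : s ≠ t) (W : Finset V)
    (hW : ∀ x, x ∈ W ↔ x ≠ s ∧ x ≠ t) (u v b : V)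
    (hu : u ∈ W) (hv : v ∈ W) (hb : b ∈ W) (huv : u ≠ v) (hub : u ≠ b)
    (hvb : v ≠ b) (e : Sym2 V) (hd : ¬ e.IsDiag) (hes : s ∉ e) (het : t ∉ e) (h1 : e ≠ s(u, b))
    (h2 : e ≠ s(v, b)) :
    (gs s t (StarE s t W) 4 {s(u, b), e}).card + (if v ∈ e then 2 else 0) =
      (gs s t (StarE s t W) 4 {s(v, b), e}).card + (if u ∈ e then 2 else 0) := by
  have hu' := (hW u).1 hu
  have hv' := (hW v).1 hv
  have hsw : ∀ e', Sym2.map (Equiv.swap u v) e' = e' →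
      (gs s t (StarE s t W) 4 {s(u, b), e'}).card = (gs s t (StarE s t W) 4 {s(v, b), e'}).card := by
    intro e' he'
    rw [← gs_swap (StarE s t W) {s(u, b), e'} u v hu'.1 hu'.2 hv'.1 hv'.2
      (StarE_swap W hW u v hu hv), Finset.image_insert, Finset.image_singleton, he', Sym2.map_mk,
      Equiv.swap_apply_left, Equiv.swap_apply_of_ne_of_ne hub.symm hvb.symm]
  induction e with | _ x y =>
  have gen : ∀ x, s(u, x) ≠ s(u, b) → x ≠ u → x ≠ v → x ≠ s → x ≠ t → 
      (gs s t (StarE s t W) 4 {s(u, b), s(u, x)}).card =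
      (gs s t (StarE s t W) 4 {s(v, b), s(u, x)}).card + 2 := by
    intro x h1 h2 h3 h4 h5
    exact gs_ux hst W hW u v b x hu hv hb ((hW x).2 ⟨h4, h5⟩) huv hub hvb h2 h3
      (by rintro rfl; exact h1 rfl)
  have gen' : ∀ x, s(v, x) ≠ s(v, b) → x ≠ u → x ≠ v → x ≠ s → x ≠ t → 
      (gs s t (StarE s t W) 4 {s(v, b), s(v, x)}).card =
      (gs s t (StarE s t W) 4 {s(u, b), s(v, x)}).card + 2 := by
    intro x h1 h2 h3 h4 h5
    exact gs_ux hst W hW v u b x hv hu hb ((hW x).2 ⟨h4, h5⟩) huv.symm hvb hub h3 h2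
      (by rintro rfl; exact h1 rfl)
  simp only [Sym2.mem_iff, Sym2.mk_isDiag_iff, not_or] at hd hes het ⊢
  by_cases hxu : x = u
  · subst hxu
    by_cases hyv : y = v
    · subst hyv
      rw [hsw _ (by simp [Sym2.eq_swap])]
      simp
    · rw [gen y h1 (Ne.symm hd) hyv (Ne.symm hes.2) (Ne.symm het.2)]
      simp [huv.symm, Ne.symm hyv]
  by_cases hxv : x = v
  · subst hxv
    by_cases hyu : y = u
    · subst hyu
      rw [hsw _ (by simp [Sym2.eq_swap])]
      simp
    · rw [gen' y h2 hyu (Ne.symm hd) (Ne.symm hes.2) (Ne.symm het.2)]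
      simp [huv, Ne.symm hyu]
  by_cases hyu : y = u
  · subst hyu
    rw [Sym2.eq_swap] at h1 h2
    rw [Sym2.eq_swap (a := x), gen x h1 hxu hxv (Ne.symm hes.1) (Ne.symm het.1)]
    simp [huv.symm, Ne.symm hxv]
  by_cases hyv : y = v
  · subst hyv
    rw [Sym2.eq_swap] at h1 h2
    rw [Sym2.eq_swap (a := x), gen' x h2 hxu hxv (Ne.symm hes.1) (Ne.symm het.1)]
    simp [huv, Ne.symm hxu]
  rw [hsw]
  · simp [Ne.symm hxu, Ne.symm hxv, Ne.symm hyu, Ne.symm hyv]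
  · rw [Sym2.map_mk, Equiv.swap_apply_of_ne_of_ne hxu hxv, Equiv.swap_apply_of_ne_of_ne hyu hyv]

open Classical in
theorem sum_powerset_one {α : Type} (K : Finset α) (f : Finset α → ℤ) (h0 : f ∅ = 0)
    (h2 : ∀ J ⊆ K, 2 ≤ J.card → f J = 0) : ∑ J ∈ K.powerset, f J = ∑ e ∈ K, f {e} := by
  have : ∑ J ∈ K.powersetCard 1, f J = ∑ J ∈ K.powerset, f J := by
    apply Finset.sum_subset
    · intro J hJ; exact Finset.mem_powerset.2 (Finset.mem_powersetCard.1 hJ).1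
    · intro J hJ hJ'
      rw [Finset.mem_powerset] at hJ
      rw [Finset.mem_powersetCard] at hJ'
      by_cases hc : J.card = 0
      · rw [Finset.card_eq_zero.1 hc, h0]
      · apply h2 J hJ
        have : J.card ≠ 1 := fun h => hJ' ⟨hJ, h⟩
        omega
  rw [← this, Finset.powersetCard_one, Finset.sum_map]
  rfl

open Classical in
theorem NF_move {V : Type} {s t : V} (hst : s ≠ t) (W : Finset V)
    (hW : ∀ x, x ∈ W ↔ x ≠ s ∧ x ≠ t) (u v b : V)
    (hu : u ∈ W) (hv : v ∈ W) (hb : b ∈ W) (huv : u ≠ v) (hub : u ≠ b)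
    (hvb : v ≠ b) (K : Finset (Sym2 V)) (hK : NT s t K) (hKd : ∀ e ∈ K, ¬ e.IsDiag)
    (hu1 : s(u, b) ∉ K) (hv1 : s(v, b) ∉ K) (i : ℕ) (hi : i ≤ 4) :
    (NF s t (StarE s t W ∪ insert s(u, b) K) i : ℤ) - NF s t (StarE s t W ∪ insert s(v, b) K) i =
      if i = 4 then 2 * ((K.filter (fun e => u ∈ e)).card - (K.filter (fun e => v ∈ e)).card : ℤ)
      else 0 := by
  have hu' := (hW u).1 hu
  have hv' := (hW v).1 hv
  have hb' := (hW b).1 hb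
  have hNu : ∀ J ⊆ K, NT s t (insert s(u, b) J) := by
    intro J hJ e he
    rw [Finset.mem_insert] at he
    rcases he with rfl | he
    · simp only [Sym2.mem_iff]; grind
    · exact hK e (hJ he)
  have hNv : ∀ J ⊆ K, NT s t (insert s(v, b) J) := by
    intro J hJ e he
    rw [Finset.mem_insert] at he
    rcases he with rfl | he
    · simp only [Sym2.mem_iff]; grind
    · exact hK e (hJ he)
  have hdis : ∀ J, NT s t J → Disjoint (StarE s t W) J := by
    intro J hJ
    rw [Finset.disjoint_left]
    intro e he he'
    have := hJ e he'
    rw [mem_StarE] at he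
    rcases he with rfl | ⟨x, hx, rfl⟩ | ⟨x, hx, rfl⟩ <;> simp at this
  rw [NF_sum _ _ _ _ (hdis _ (hNu K subset_rfl)), NF_sum _ _ _ _ (hdis _ (hNv K subset_rfl)),
    Finset.sum_powerset_insert hu1, Finset.sum_powerset_insert hv1]
  push_cast
  rw [add_sub_add_left_eq_sub, ← Finset.sum_sub_distrib]
  have hcu : ∀ J ⊆ K, (insert s(u, b) J).card = J.card + 1 := fun J hJ =>
    Finset.card_insert_of_notMem (fun h => hu1 (hJ h))
  have hcv : ∀ J ⊆ K, (insert s(v, b) J).card = J.card + 1 := fun J hJ =>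
    Finset.card_insert_of_notMem (fun h => hv1 (hJ h))
  rw [sum_powerset_one]
  · split_ifs with h4
    · subst h4
      rw [mul_sub, Finset.card_filter, Finset.card_filter]
      push_cast
      rw [Finset.mul_sum, Finset.mul_sum, ← Finset.sum_sub_distrib]
      apply Finset.sum_congr rfl
      intro e he
      have := gs_diff hst W hW u v b hu hv hb huv hub hvb e (hKd e he) (hK e he).1 (hK e he).2
        (fun h => hu1 (h ▸ he)) (fun h => hv1 (h ▸ he))
      split_ifs at this ⊢ <;> omega
    · apply Finset.sum_eq_zero
      intro e he
      have hsub : ({e} : Finset (Sym2 V)) ⊆ K := by simpa using he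
      rw [gs_small hst _ _ _ (hNu {e} hsub) (hNv {e} hsub)
        (by rw [hcu _ hsub, hcv _ hsub]) i (by rw [hcu _ hsub, Finset.card_singleton]; omega)]
      simp
  · rw [← gs_swap (StarE s t W) (insert s(u, b) ∅) u v hu'.1 hu'.2 hv'.1 hv'.2
      (StarE_swap W hW u v hu hv), Finset.image_insert, Finset.image_empty, Sym2.map_mk,
      Equiv.swap_apply_left, Equiv.swap_apply_of_ne_of_ne hub.symm hvb.symm]
    simp
  · intro J hJ hc
    rw [gs_small hst _ _ _ (hNu J hJ) (hNv J hJ) (by rw [hcu _ hJ, hcv _ hJ]) i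
      (by rw [hcu _ hJ]; omega)]
    simp

open Classical in
theorem thr {n m : ℕ} {G : TwoTerminalGraph n} (hG : IsLMRTTG n m G)
    (hDs : ∀ v, v ≠ G.s → G.graph.Adj G.s v) (hDt : ∀ v, v ≠ G.t → G.graph.Adj G.t v) :
    ∃ d : Fin n → ℕ, ∀ u v b, u ≠ G.s → u ≠ G.t →
      v ≠ G.s → v ≠ G.t → b ≠ G.s → b ≠ G.t → u ≠ b → G.graph.Adj v b →
      ¬ G.graph.Adj u b → d u < d v := by
  refine ⟨fun x => ((EF G \ StarE G.s G.t (Finset.univ.filter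
    (fun x => x ≠ G.s ∧ x ≠ G.t))).filter (fun e => x ∈ e)).card, ?_⟩
  intro u v b hus hut hvs hvt hbs hbt hub hadj hnadj
  set W : Finset (Fin n) := Finset.univ.filter (fun x => x ≠ G.s ∧ x ≠ G.t) with hWdef
  have hW : ∀ x, x ∈ W ↔ x ≠ G.s ∧ x ≠ G.t := by intro x; simp [hWdef]
  have huv : u ≠ v := by rintro rfl; exact hnadj hadj
  have hvb : v ≠ b := hadj.ne
  have hSt : StarE G.s G.t W ⊆ EF G := by
    intro e he
    rw [mem_StarE] at he
    rcases he with rfl | ⟨x, hx, rfl⟩ | ⟨x, hx, rfl⟩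
    · rw [mem_EF]; exact hDs _ G.hst.symm
    · rw [mem_EF]; exact hDs _ ((hW x).1 hx).1
    · rw [mem_EF]; exact hDt _ ((hW x).1 hx).2
  set Hs := EF G \ StarE G.s G.t W with hHs
  have hHNT : NT G.s G.t Hs := by
    intro e he
    rw [hHs, Finset.mem_sdiff, mem_StarE] at he
    obtain ⟨h1, h2⟩ := he
    have hd := EF_not_diag G e h1
    have key : ∀ x y, s(x, y) = e → x ≠ G.s ∧ x ≠ G.t := by
      rintro x y rfl
      have hxy : x ≠ y := by simpa using hd
      constructor
      · rintro rfl
        apply h2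
        by_cases hy : y = G.t
        · subst hy; exact Or.inl rfl
        · exact Or.inr (Or.inl ⟨y, (hW y).2 ⟨hxy.symm, hy⟩, rfl⟩)
      · rintro rfl
        apply h2
        by_cases hy : y = G.s
        · subst hy; exact Or.inl Sym2.eq_swap
        · exact Or.inr (Or.inr ⟨y, (hW y).2 ⟨hy, hxy.symm⟩, rfl⟩)
    constructor
    · intro hmem
      obtain ⟨y, rfl⟩ := hmem
      exact (key _ _ rfl).1 rfl
    · intro hmem
      obtain ⟨y, rfl⟩ := hmem
      exact (key _ _ rfl).2 rfl
  have hvbH : s(v, b) ∈ Hs := by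
    rw [hHs, Finset.mem_sdiff, mem_EF, mem_StarE]
    refine ⟨hadj, ?_⟩
    simp only [Sym2.eq_iff]
    grind
  have hubH : s(u, b) ∉ Hs := by
    rw [hHs, Finset.mem_sdiff, mem_EF]
    exact fun h => hnadj h.1
  set K := Hs.erase s(v, b) with hK
  have hKH : K ⊆ Hs := Finset.erase_subset _ _
  have hKNT : NT G.s G.t K := fun e he => hHNT e (hKH he)
  have hHd : ∀ e ∈ Hs, ¬ e.IsDiag := fun e he => EF_not_diag G e (Finset.mem_sdiff.1 he).1
  have hins : insert s(v, b) K = Hs := Finset.insert_erase hvbH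
  have hEG : StarE G.s G.t W ∪ insert s(v, b) K = EF G := by
    rw [hins, hHs, Finset.union_sdiff_of_subset hSt]
  have hu1 : s(u, b) ∉ K := fun h => hubH (hKH h)
  have hv1 : s(v, b) ∉ K := Finset.notMem_erase _ _
  have hmv : ∀ i ≤ 4, (NF G.s G.t (StarE G.s G.t W ∪ insert s(u, b) K) i : ℤ) -
      NF G.s G.t (StarE G.s G.t W ∪ insert s(v, b) K) i = if i = 4 then
      2 * ((K.filter (fun e => u ∈ e)).card - (K.filter (fun e => v ∈ e)).card : ℤ) else 0 := by
    intro i hi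
    convert NF_move G.hst W hW u v b ((hW u).2 ⟨hus, hut⟩) ((hW v).2 ⟨hvs, hvt⟩)
      ((hW b).2 ⟨hbs, hbt⟩) huv hub hvb K hKNT (fun e he => hHd e (hKH he)) hu1 hv1 i hi
  rw [hEG] at hmv
  set E' := StarE G.s G.t W ∪ insert s(u, b) K with hE'
  have hsW : G.s ∉ W := by simp [hW]
  have htW : G.t ∉ W := by simp [hW]
  have hE'd : ∀ e ∈ E', ¬ e.IsDiag := by
    intro e he
    rw [hE', Finset.mem_union, Finset.mem_insert] at he
    rcases he with he | rfl | he
    · exact StarE_not_diag _ _ G.hst _ hsW htW e he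
    · simpa using hub
    · exact hHd e (hKH he)
  have hubS : s(u, b) ∉ StarE G.s G.t W := fun h => hnadj ((mem_EF _ _ _).1 (hSt h))
  have hE'c : E'.card = m := by
    have h3 : edgeCount G.graph = m := hG.1
    have hvbS : s(v, b) ∉ StarE G.s G.t W := (Finset.mem_sdiff.1 hvbH).2
    have hdK : Disjoint (StarE G.s G.t W) K :=
      Finset.disjoint_of_subset_right hKH Finset.disjoint_sdiff
    rw [← card_EF, ← hEG, Finset.card_union_of_disjoint, Finset.card_insert_of_notMem hv1] at h3
    · rw [hE', Finset.card_union_of_disjoint, Finset.card_insert_of_notMem hu1, h3]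
      rw [Finset.disjoint_insert_right]; exact ⟨hubS, hdK⟩
    · rw [Finset.disjoint_insert_right]; exact ⟨hvbS, hdK⟩
  have hT := mkG_TT G.s G.t G.hst E' hE'd hE'c
  have hN : ∀ i, Ncoeff (mkG G.s G.t G.hst E') i = NF G.s G.t E' i := by
    intro i; rw [Ncoeff_eq, EF_mkG G.s G.t G.hst E' hE'd]; rfl
  have hle := lex_le (k := 4) hG hT (by
    intro j hj
    have := hmv j hj.le
    rw [if_neg hj.ne] at this
    rw [hN, Ncoeff_eq]
    omega)
  rw [hN, Ncoeff_eq] at hle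
  have h4 := hmv 4 le_rfl
  rw [if_pos rfl] at h4
  have hfin : (K.filter (fun e => u ∈ e)).card ≤ (K.filter (fun e => v ∈ e)).card := by omega
  show (Hs.filter (fun e => u ∈ e)).card < (Hs.filter (fun e => v ∈ e)).card
  rw [← hins, Finset.filter_insert, Finset.filter_insert, if_neg, if_pos,
    Finset.card_insert_of_notMem]
  · omega
  · intro h; exact hv1 (Finset.mem_filter.1 h).1
  · simp
  · simp only [Sym2.mem_iff]; grind

open Classical in
theorem drop_pendant {V : Type} {s t z y : V} (hzs : z ≠ s) (hzt : z ≠ t) (hzy : z ≠ y)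
    (F : Finset (Sym2 V)) (hF : ∀ e ∈ F, e ≠ s(z, y) → z ∉ e) (h : cn s t F) :
    cn s t (F.erase s(z, y)) := by
  have := cn_closed h {w | if w = z then cn s y (F.erase s(z, y)) else cn s w (F.erase s(z, y))}
    (by
      change if s = z then _ else _
      rw [if_neg hzs.symm]; exact cn_refl _ _) (by
      intro a b hab ha
      simp only [Set.mem_ofPred_eq] at ha ⊢
      by_cases he : s(a, b) = s(z, y)
      · rw [Sym2.eq_iff] at he
        rcases he with ⟨rfl, rfl⟩ | ⟨rfl, rfl⟩
        · rw [if_pos rfl] at ha; rw [if_neg hzy.symm]; exact ha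
        · rw [if_neg hzy.symm] at ha; rw [if_pos rfl]; exact ha
      · have hz := hF _ hab he
        rw [Sym2.mem_iff, not_or] at hz
        rw [if_neg (Ne.symm hz.1)] at ha
        rw [if_neg (Ne.symm hz.2)]
        exact cn_trans ha (cn_edge (Finset.mem_erase.2 ⟨he, hab⟩)))
  simp only [Set.mem_ofPred_eq] at this
  rwa [if_neg hzt.symm] at this

open Classical in
theorem not_pendant {n m : ℕ} {G : TwoTerminalGraph n} (hG : IsLMRTTG n m G) (C : Finset (Fin n))
    (hs : G.s ∉ C) (ht : G.t ∉ C) (hC : 2 ≤ C.card) (z y : Fin n) (hzC : z ∉ C) (hzs : z ≠ G.s)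
    (hzt : z ≠ G.t) (hzy : z ≠ y) (hE : EF G = insert s(z, y) (StarE G.s G.t C)) : False := by
  obtain ⟨a, ha, b, hb, hab⟩ := Finset.one_lt_card.1 (by omega : 1 < C.card)
  have has : a ≠ G.s := fun h => hs (h ▸ ha)
  have hat : a ≠ G.t := fun h => ht (h ▸ ha)
  have hbs : b ≠ G.s := fun h => hs (h ▸ hb)
  have hbt : b ≠ G.t := fun h => ht (h ▸ hb)
  have hst := G.hst
  have hzS : ∀ e ∈ StarE G.s G.t C, z ∉ e := by
    intro e he
    rw [mem_StarE] at he
    rcases he with rfl | ⟨v, hv, rfl⟩ | ⟨v, hv, rfl⟩ <;> rw [Sym2.mem_iff] <;> grind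
  have hf : s(z, y) ∉ StarE G.s G.t C := fun h => hzS _ h (by simp)
  have habS : s(a, b) ∉ StarE G.s G.t C := by
    rw [mem_StarE]; simp only [Sym2.eq_iff]; grind
  set E' := insert s(a, b) (StarE G.s G.t C) with hE'
  have hE'd : ∀ e ∈ E', ¬ e.IsDiag := by
    intro e he
    rw [hE', Finset.mem_insert] at he
    rcases he with rfl | he
    · simpa using hab
    · exact StarE_not_diag _ _ G.hst _ hs ht e he
  have hE'c : E'.card = m := by
    have h3 : edgeCount G.graph = m := hG.1
    rw [← card_EF, hE, Finset.card_insert_of_notMem hf] at h3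
    rw [hE', Finset.card_insert_of_notMem habS, h3]
  have hT := mkG_TT G.s G.t G.hst E' hE'd hE'c
  have hN : ∀ i, Ncoeff (mkG G.s G.t G.hst E') i = NF G.s G.t E' i := by
    intro i; rw [Ncoeff_eq, EF_mkG G.s G.t G.hst E' hE'd]; rfl
  let φ : Sym2 (Fin n) → Sym2 (Fin n) := fun e => if e = s(z, y) then s(a, b) else e
  have hφ1 : φ s(z, y) = s(a, b) := if_pos rfl
  have hφ2 : ∀ e, e ≠ s(z, y) → φ e = e := fun e he => if_neg he
  have hmem : ∀ e ∈ EF G, e = s(z, y) ∨ e ∈ StarE G.s G.t C := by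
    intro e he; rw [hE] at he; simpa using he
  have hinj : Set.InjOn φ (EF G) := by
    intro e he e' he' heq
    have h1 := hmem e he
    have h2 := hmem e' he'
    by_cases h : e = s(z, y) <;> by_cases h' : e' = s(z, y)
    · rw [h, h']
    · rw [h, hφ1, hφ2 _ h'] at heq
      exact absurd (heq ▸ h2.resolve_left h') habS
    · rw [h', hφ1, hφ2 _ h] at heq
      exact absurd (heq ▸ h1.resolve_left h) habS
    · rwa [hφ2 _ h, hφ2 _ h'] at heq
  have hmaps : ∀ e ∈ EF G, φ e ∈ E' := by
    intro e he
    by_cases h : e = s(z, y)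
    · rw [h, hφ1]; simp [hE']
    · rw [hφ2 _ h]; exact Finset.mem_insert_of_mem ((hmem e he).resolve_left h)
  have hpend : ∀ F ⊆ EF G, cn G.s G.t F → cn G.s G.t (F.erase s(z, y)) := by
    intro F hF h
    convert drop_pendant hzs hzt hzy F (fun e he hne => hzS e ((hmem e (hF he)).resolve_left hne)) h
  have hcn : ∀ F ⊆ EF G, cn G.s G.t F → cn G.s G.t (F.image φ) := by
    intro F hF h
    refine cn_mono ?_ (hpend F hF h)
    intro e he
    rw [Finset.mem_erase] at he
    exact Finset.mem_image.2 ⟨e, he.2, hφ2 _ he.1⟩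
  have hle : ∀ k, NF G.s G.t (EF G) k ≤ NF G.s G.t E' k := fun k =>
    NF_le _ _ _ _ _ _ φ hinj hmaps k (fun F hF _ h => by convert hcn F hF h)
  have h1 : s(G.s, a) ∈ StarE G.s G.t C := (mem_StarE _ _ _ _).2 (Or.inr (Or.inl ⟨a, ha, rfl⟩))
  have h2 : s(G.t, b) ∈ StarE G.s G.t C := (mem_StarE _ _ _ _).2 (Or.inr (Or.inr ⟨b, hb, rfl⟩))
  have h1' : s(G.s, a) ≠ s(z, y) := fun h => hf (h ▸ h1)
  have h2' : s(G.t, b) ≠ s(z, y) := fun h => hf (h ▸ h2)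
  have h12 : s(G.s, a) ≠ s(G.t, b) := by intro h; rw [Sym2.eq_iff] at h; grind
  have hF0 : ({s(z, y), s(G.s, a), s(G.t, b)} : Finset (Sym2 (Fin n))) ⊆ EF G := by
    intro e he
    rw [hE]
    simp only [Finset.mem_insert, Finset.mem_singleton] at he ⊢
    rcases he with rfl | rfl | rfl
    · exact Or.inl rfl
    · exact Or.inr h1
    · exact Or.inr h2
  have hlt : NF G.s G.t (EF G) 3 < NF G.s G.t E' 3 := by
    refine NF_lt _ _ _ _ _ _ φ hinj hmaps 3 (fun F hF _ h => by convert hcn F hF h)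
      {s(z, y), s(G.s, a), s(G.t, b)} (by convert hF0) ?_ ?_ ?_
    · rw [Finset.card_eq_three]
      exact ⟨_, _, _, h1'.symm, h2'.symm, h12, by congr!⟩
    · intro h
      have h5 := hpend {s(z, y), s(G.s, a), s(G.t, b)} hF0 (by convert h)
      have := cn_closed h5 {G.s, a} (by simp) (by
        intro p q hpq hp
        simp only [Finset.mem_erase, Finset.mem_insert, Finset.mem_singleton] at hpq
        have hpq := hpq.2.resolve_left hpq.1
        simp only [Sym2.eq_iff] at hpq
        simp only [Set.mem_insert_iff, Set.mem_singleton_iff] at hp ⊢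
        grind)
      simp only [Set.mem_insert_iff, Set.mem_singleton_iff] at this
      grind
    · have m1 : s(G.s, a) ∈ Finset.image φ {s(z, y), s(G.s, a), s(G.t, b)} :=
        Finset.mem_image.2 ⟨_, by simp, hφ2 _ h1'⟩
      have m2 : s(G.t, b) ∈ Finset.image φ {s(z, y), s(G.s, a), s(G.t, b)} :=
        Finset.mem_image.2 ⟨_, by simp, hφ2 _ h2'⟩
      have m3 : s(a, b) ∈ Finset.image φ {s(z, y), s(G.s, a), s(G.t, b)} :=
        Finset.mem_image.2 ⟨s(z, y), by simp, hφ1⟩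
      have := cn_trans (cn_edge m1) (cn_trans (cn_edge m3) (cn_symm (cn_edge m2)))
      convert this
  have := dom_eq hG hT (fun k => by rw [hN, Ncoeff_eq]; exact hle k) 3
  rw [hN, Ncoeff_eq] at this
  omega

open Classical in
theorem structB {n m : ℕ} (hm1 : 5 ≤ m) (hm : m ≤ n.choose 2) (hB : m < 2 * (n - 2) + 1)
    {G : TwoTerminalGraph n} (hG : IsLMRTTG n m G) :
    ∃ C D : Finset (Fin n), C.card = (m - 1) / 2 ∧ D.card = 2 * ((m - 1) % 2) ∧ D ⊆ C ∧
      G.s ∉ C ∧ G.t ∉ C ∧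
      ∀ x y, G.graph.Adj x y ↔ s(x, y) ∈ StarE G.s G.t C ∨ (x ∈ D ∧ y ∈ D ∧ x ≠ y) := by
  obtain ⟨h1, h2⟩ := opt_basic hm hG ((m - 1) / 2) (by omega) (by omega)
  set C := CNf G.s G.t (EF G) with hCdef
  have hC : ∀ x, x ∈ C ↔ x ≠ G.s ∧ x ≠ G.t ∧ s(G.s, x) ∈ EF G ∧ s(G.t, x) ∈ EF G := by
    intro x; simp [hCdef, CNf]
  have hs : G.s ∉ C := by simp [hC]
  have ht : G.t ∉ C := by simp [hC]
  have hsub : StarE G.s G.t C ⊆ EF G := by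
    intro e he
    rw [mem_StarE] at he
    rcases he with rfl | ⟨v, hv, rfl⟩ | ⟨v, hv, rfl⟩
    · exact h1
    · exact ((hC v).1 hv).2.2.1
    · exact ((hC v).1 hv).2.2.2
  have hcS := card_StarE G.s G.t G.hst C hs ht
  have hcE : (EF G).card = m := by
    have h3 : edgeCount G.graph = m := hG.1
    rw [card_EF, h3]
  have hle := Finset.card_le_card hsub
  have hCc : C.card = (m - 1) / 2 := by omega
  rcases Nat.mod_two_eq_zero_or_one (m - 1) with hpar | hpar
  · refine ⟨C, ∅, hCc, by simp [hpar], by simp, hs, ht, ?_⟩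
    have : StarE G.s G.t C = EF G := Finset.eq_of_subset_of_card_le hsub (by omega)
    intro x y
    rw [this, mem_EF]; simp
  · have hcd : (EF G \ StarE G.s G.t C).card = 1 := by
      rw [Finset.card_sdiff_of_subset hsub]; omega
    obtain ⟨f, hf⟩ := Finset.card_eq_one.1 hcd
    have hfm : f ∈ EF G \ StarE G.s G.t C := by rw [hf]; simp
    rw [Finset.mem_sdiff] at hfm
    have hE : EF G = insert f (StarE G.s G.t C) := by
      rw [← Finset.sdiff_union_of_subset hsub, hf, Finset.insert_eq]
    have hfd := EF_not_diag G f hfm.1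
    induction f with | _ x y =>
    have hxy : x ≠ y := by simpa using hfd
    have key : ∀ z w, s(z, w) = s(x, y) → z ∈ C ∨ z = G.s ∨ z = G.t := by
      intro z w hzw
      by_contra hcon
      push Not at hcon
      rw [← hzw] at hE hfd
      exact not_pendant hG C hs ht (by omega) z w hcon.1 hcon.2.1 hcon.2.2 (by simpa using hfd)
        (by convert hE)
    have kx := key x y rfl
    have ky := key y x Sym2.eq_swap
    have hnS := hfm.2
    rw [mem_StarE] at hnS
    simp only [Sym2.eq_iff] at hnS
    have hxC : x ∈ C := by grind
    have hyC : y ∈ C := by grind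
    refine ⟨C, {x, y}, hCc, by rw [Finset.card_pair hxy, hpar], ?_, hs, ht, ?_⟩
    · intro z hz
      simp only [Finset.mem_insert, Finset.mem_singleton] at hz
      rcases hz with rfl | rfl <;> assumption
    · intro p q
      rw [← mem_EF, hE, Finset.mem_insert, or_comm]
      refine or_congr_right ?_
      simp only [Finset.mem_insert, Finset.mem_singleton, Sym2.eq_iff]
      grind

theorem mem_StarE_mk {V : Type} (s t : V) (C : Finset V) (x y : V) : s(x, y) ∈ StarE s t C ↔
    (x = s ∧ y = t) ∨ (x = t ∧ y = s) ∨ (x = s ∧ y ∈ C) ∨ (y = s ∧ x ∈ C) ∨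
    (x = t ∧ y ∈ C) ∨ (y = t ∧ x ∈ C) := by
  rw [mem_StarE]
  simp only [Sym2.eq_iff]
  constructor
  · rintro ((⟨rfl, rfl⟩ | ⟨rfl, rfl⟩) | ⟨v, hv, ⟨rfl, rfl⟩ | ⟨rfl, rfl⟩⟩ |
      ⟨v, hv, ⟨rfl, rfl⟩ | ⟨rfl, rfl⟩⟩) <;> simp [*]
  · rintro (⟨rfl, rfl⟩ | ⟨rfl, rfl⟩ | ⟨rfl, h⟩ | ⟨rfl, h⟩ | ⟨rfl, h⟩ | ⟨rfl, h⟩)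
    · simp
    · simp
    · exact Or.inr (Or.inl ⟨_, h, by simp⟩)
    · exact Or.inr (Or.inl ⟨_, h, by simp⟩)
    · exact Or.inr (Or.inr ⟨_, h, by simp⟩)
    · exact Or.inr (Or.inr ⟨_, h, by simp⟩)

open Classical in
theorem uniqB {n : ℕ} (G H : TwoTerminalGraph n) (C D C' D' : Finset (Fin n))
    (hc : C.card = C'.card) (hd : D.card = D'.card) (hD : D ⊆ C) (hD' : D' ⊆ C')
    (hs : G.s ∉ C) (ht : G.t ∉ C) (hs' : H.s ∉ C') (ht' : H.t ∉ C')
    (hG : ∀ x y, G.graph.Adj x y ↔ s(x, y) ∈ StarE G.s G.t C ∨ (x ∈ D ∧ y ∈ D ∧ x ≠ y))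
    (hH : ∀ x y, H.graph.Adj x y ↔ s(x, y) ∈ StarE H.s H.t C' ∨ (x ∈ D' ∧ y ∈ D' ∧ x ≠ y)) :
    ∃ σ, relabel σ H = G := by
  let κ : TwoTerminalGraph n → Finset (Fin n) → Finset (Fin n) → Fin n → ℕ := fun G C D x =>
    if x = G.s then 0 else if x = G.t then 1 else if x ∈ D then 2 else if x ∈ C then 3 else 4
  have fib : ∀ (G : TwoTerminalGraph n) (C D : Finset (Fin n)), D ⊆ C → G.s ∉ C → G.t ∉ C →
      (Finset.univ.filter (fun v => κ G C D v = 0) = {G.s}) ∧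
      (Finset.univ.filter (fun v => κ G C D v = 1) = {G.t}) ∧
      (Finset.univ.filter (fun v => κ G C D v = 2) = D) ∧
      (Finset.univ.filter (fun v => κ G C D v = 3) = C \ D) ∧
      (Finset.univ.filter (fun v => κ G C D v = 4) = Finset.univ \ insert G.s (insert G.t C)) ∧
      (∀ i, 5 ≤ i → Finset.univ.filter (fun v => κ G C D v = i) = ∅) := by
    intro G C D hD hs ht
    have hst := G.hst
    have hD' : ∀ x ∈ D, x ∈ C := fun x hx => hD hx
    refine ⟨?_, ?_, ?_, ?_, ?_, ?_⟩
    · ext x; simp only [κ, Finset.mem_filter, Finset.mem_univ, true_and, Finset.mem_singleton]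
      split_ifs <;> grind
    · ext x; simp only [κ, Finset.mem_filter, Finset.mem_univ, true_and, Finset.mem_singleton]
      split_ifs <;> grind
    · ext x; simp only [κ, Finset.mem_filter, Finset.mem_univ, true_and]
      split_ifs <;> grind
    · ext x; simp only [κ, Finset.mem_filter, Finset.mem_univ, true_and, Finset.mem_sdiff]
      split_ifs <;> grind
    · ext x; simp only [κ, Finset.mem_filter, Finset.mem_univ, true_and, Finset.mem_sdiff,
        Finset.mem_insert]
      split_ifs <;> grind
    · intro i hi
      ext x; simp only [κ, Finset.mem_filter, Finset.mem_univ, true_and, Finset.notMem_empty,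
        iff_false]
      split_ifs <;> omega
  have fG := fib G C D hD hs ht
  have fH := fib H C' D' hD' hs' ht'
  obtain ⟨σ, hσ⟩ := exists_perm_of_fibers (κ H C' D') (κ G C D) (by
    intro i
    by_cases hi : 5 ≤ i
    · rw [fG.2.2.2.2.2 i hi, fH.2.2.2.2.2 i hi]
    · have hi : i < 5 := by omega
      interval_cases i
      · rw [fG.1, fH.1]; simp
      · rw [fG.2.1, fH.2.1]; simp
      · rw [fG.2.2.1, fH.2.2.1, hd]
      · rw [fG.2.2.2.1, fH.2.2.2.1, Finset.card_sdiff_of_subset hD, Finset.card_sdiff_of_subset hD',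
          hc, hd]
      · rw [fG.2.2.2.2.1, fH.2.2.2.2.1, Finset.card_sdiff_of_subset (Finset.subset_univ _),
          Finset.card_sdiff_of_subset (Finset.subset_univ _),
          Finset.card_insert_of_notMem (by simp [H.hst, hs']), Finset.card_insert_of_notMem ht',
          Finset.card_insert_of_notMem (by simp [G.hst, hs]), Finset.card_insert_of_notMem ht,
          hc])
  have tr : ∀ v, (σ v = G.s ↔ v = H.s) ∧ (σ v = G.t ↔ v = H.t) ∧ (σ v ∈ D ↔ v ∈ D') ∧
      (σ v ∈ C ↔ v ∈ C') := by
    intro v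
    have e1 : ∀ x, κ G C D x = 0 ↔ x = G.s := by
      intro x; have := Finset.ext_iff.1 fG.1 x; simpa using this
    have e2 : ∀ x, κ G C D x = 1 ↔ x = G.t := by
      intro x; have := Finset.ext_iff.1 fG.2.1 x; simpa using this
    have e3 : ∀ x, κ G C D x = 2 ↔ x ∈ D := by
      intro x; have := Finset.ext_iff.1 fG.2.2.1 x; simpa using this
    have e4 : ∀ x, κ G C D x = 3 ↔ x ∈ C ∧ x ∉ D := by
      intro x; have := Finset.ext_iff.1 fG.2.2.2.1 x; simpa using this
    have e1' : ∀ x, κ H C' D' x = 0 ↔ x = H.s := by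
      intro x; have := Finset.ext_iff.1 fH.1 x; simpa using this
    have e2' : ∀ x, κ H C' D' x = 1 ↔ x = H.t := by
      intro x; have := Finset.ext_iff.1 fH.2.1 x; simpa using this
    have e3' : ∀ x, κ H C' D' x = 2 ↔ x ∈ D' := by
      intro x; have := Finset.ext_iff.1 fH.2.2.1 x; simpa using this
    have e4' : ∀ x, κ H C' D' x = 3 ↔ x ∈ C' ∧ x ∉ D' := by
      intro x; have := Finset.ext_iff.1 fH.2.2.2.1 x; simpa using this
    have hd3 : σ v ∈ D ↔ v ∈ D' := by rw [← e3, ← e3', hσ]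
    have hd4 : (σ v ∈ C ∧ σ v ∉ D) ↔ (v ∈ C' ∧ v ∉ D') := by rw [← e4, ← e4', hσ]
    refine ⟨by rw [← e1, ← e1', hσ], by rw [← e2, ← e2', hσ], hd3, ?_⟩
    have i1 := @hD (σ v)
    have i2 := @hD' v
    tauto
  refine ⟨σ, ttg_ext ?_ ?_ ?_⟩
  · exact (tr H.s).1.2 rfl
  · exact (tr H.t).2.1.2 rfl
  · intro a b
    obtain ⟨x, rfl⟩ := σ.surjective a
    obtain ⟨y, rfl⟩ := σ.surjective b
    change H.graph.Adj (σ.symm (σ x)) (σ.symm (σ y)) ↔ _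
    rw [Equiv.symm_apply_apply, Equiv.symm_apply_apply, hG, hH]
    rw [mem_StarE_mk, mem_StarE_mk]
    obtain ⟨a1, a2, a3, a4⟩ := tr x
    obtain ⟨b1, b2, b3, b4⟩ := tr y
    rw [a1, a2, a3, a4, b1, b2, b3, b4, σ.injective.ne_iff]

theorem uniqAll {n m : ℕ} (hn : 4 ≤ n) (hm1 : 5 ≤ m) (hm : m ≤ n.choose 2)
    (G H : TwoTerminalGraph n) (hG : IsLMRTTG n m G) (hH : IsLMRTTG n m H) :
    ∃ σ, relabel σ H = G := by
  classical
  by_cases hB : m < 2 * (n - 2) + 1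
  · obtain ⟨C, D, h1, h2, h3, h4, h5, h6⟩ := structB hm1 hm hB hG
    obtain ⟨C', D', h1', h2', h3', h4', h5', h6'⟩ := structB hm1 hm hB hH
    exact uniqB G H C D C' D' (by rw [h1, h1']) (by rw [h2, h2']) h3 h3' h4 h5 h4' h5' h6 h6'
  have hdom : ∀ G : TwoTerminalGraph n, IsLMRTTG n m G →
      (∀ v, v ≠ G.s → G.graph.Adj G.s v) ∧ (∀ v, v ≠ G.t → G.graph.Adj G.t v) := by
    intro G hG
    obtain ⟨h1, h2⟩ := opt_basic hm hG (n - 2) le_rfl (by omega)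
    have hsub : CNf G.s G.t (EF G) ⊆ (Finset.univ.erase G.s).erase G.t := by
      intro v hv
      simp only [CNf, Finset.mem_filter] at hv
      simp [hv.2.1, hv.2.2.1]
    have heq := Finset.eq_of_subset_of_card_le hsub (by
      rw [Finset.card_erase_of_mem (by simp [G.hst.symm]), Finset.card_erase_of_mem (by simp),
        Finset.card_univ, Fintype.card_fin]; omega)
    have hall : ∀ v, v ≠ G.s → v ≠ G.t → s(G.s, v) ∈ EF G ∧ s(G.t, v) ∈ EF G := by
      intro v hs ht
      have : v ∈ CNf G.s G.t (EF G) := by rw [heq]; simp [hs, ht]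
      simp only [CNf, Finset.mem_filter] at this
      exact this.2.2.2
    constructor
    · intro v hv
      by_cases h : v = G.t
      · rw [h, ← mem_EF]; exact h1
      · rw [← mem_EF]; exact (hall v hv h).1
    · intro v hv
      by_cases h : v = G.s
      · rw [h, ← mem_EF, Sym2.eq_swap]; exact h1
      · rw [← mem_EF]; exact (hall v h hv).2
  obtain ⟨τ, hτs, hτt⟩ : ∃ τ : Equiv.Perm (Fin n), τ H.s = G.s ∧ τ H.t = G.t := by
    have hne : Equiv.swap H.s G.s H.t ≠ G.s := by
      intro h
      have h2 : Equiv.swap H.s G.s H.t = Equiv.swap H.s G.s H.s := by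
        rw [h, Equiv.swap_apply_left]
      exact H.hst ((Equiv.swap H.s G.s).injective h2).symm
    refine ⟨Equiv.swap (Equiv.swap H.s G.s H.t) G.t * Equiv.swap H.s G.s, ?_, ?_⟩
    · rw [Equiv.Perm.mul_apply, Equiv.swap_apply_left,
        Equiv.swap_apply_of_ne_of_ne hne.symm G.hst]
    · rw [Equiv.Perm.mul_apply, Equiv.swap_apply_left]
  have hH' := opt_relabel τ hH
  have hs : (relabel τ H).s = G.s := hτs
  have ht : (relabel τ H).t = G.t := hτt
  obtain ⟨dG1, dG2⟩ := hdom G hG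
  obtain ⟨dH1, dH2⟩ := hdom _ hH'
  rw [hs] at dH1
  rw [ht] at dH2
  have es : ∀ b, G.graph.Adj G.s b ↔ (relabel τ H).graph.Adj G.s b := by
    intro b
    by_cases hb : b = G.s
    · subst hb; simp
    · simp only [dG1 b hb, dH1 b hb]
  have et : ∀ b, G.graph.Adj G.t b ↔ (relabel τ H).graph.Adj G.t b := by
    intro b
    by_cases hb : b = G.t
    · subst hb; simp
    · simp only [dG2 b hb, dH2 b hb]
  have hW : ∀ z, z ∉ (Finset.univ.erase G.s).erase G.t → z = G.s ∨ z = G.t := by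
    intro z hz
    simp only [Finset.mem_erase, Finset.mem_univ, and_true] at hz
    tauto
  obtain ⟨σ, hσ⟩ := uniqA (fun G hG => thr hG (hdom G hG).1 (hdom G hG).2)
    (fun G hG => (hdom G hG).1) (fun G hG => (hdom G hG).2) G hG _ (relabel τ H) hH' hs ht
    ((Finset.univ.erase G.s).erase G.t) rfl (by simp) (by simp) (by
      intro z hz
      left
      intro w hw
      simp only [Finset.mem_erase, Finset.mem_univ, and_true] at hw
      rcases hW z hz with rfl | rfl
      · exact dG1 w hw.2
      · exact dG2 w hw.1) (by
      have key : ∀ a b, a ∉ (Finset.univ.erase G.s).erase G.t →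
          (G.graph.Adj a b ↔ (relabel τ H).graph.Adj a b) := by
        intro a b ha
        rcases hW a ha with rfl | rfl
        · exact es b
        · exact et b
      intro a b hab
      by_cases ha : a ∈ (Finset.univ.erase G.s).erase G.t
      · have hb : b ∉ (Finset.univ.erase G.s).erase G.t := fun hb => hab ⟨ha, hb⟩
        rw [G.graph.adj_comm, (relabel τ H).graph.adj_comm]
        exact key b a hb
      · exact key a b ha)
  exact ⟨σ * τ, by rw [← relabel_relabel]; exact hσ⟩

theorem stmt0 (n m : ℕ) (hn : 4 ≤ n) (hm1 : 5 ≤ m) (hm2 : m ≤ n.choose 2) :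
    ∃ G : TwoTerminalGraph n, IsLMRTTG n m G ∧
      ∀ H : TwoTerminalGraph n, IsLMRTTG n m H → TTIso G H := by
  have hne : (TT n m).Nonempty := by
    obtain ⟨E, _, h2, h3⟩ := extend_edges hm2 ∅ (by simp) (by simp)
    exact ⟨_, mkG_TT ⟨0, by omega⟩ ⟨1, by omega⟩ (by simp) E h2 h3⟩
  obtain ⟨G, hG⟩ := exists_opt hne
  refine ⟨G, hG, fun H hH => ?_⟩
  obtain ⟨σ, hσ⟩ := uniqAll hn hm1 hm2 G H hG hH
  exact iso_of_relabel σ G H hσ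
end

section
/- Let n and m be integers with n ≥ 4 and 5 ≤ m ≤ 2n−3. Define the two-terminal graph G_{n,m} with vertex set {s,t} ∪ {v_1,…,v_{n−2}}, terminals s and t, and edge set: if m is odd, E(G_{n,m}) = {st} ∪ {sv_i, v_i t : 1 ≤ i ≤ (m−1)/2}; if m is even, E(G_{n,m}) = {st} ∪ {sv_i, v_i t : 1 ≤ i ≤ (m−2)/2} ∪ {v_1 v_2}. Then G_{n,m} is a locally most reliable two-terminal graph in T_{n,m}, and every locally most reliable two-terminal graph in T_{n,m} is isomorphic (as a two-terminal graph) to G_{n,m}. -/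
/-- The graph `G_{n,m}` of Definition 4: terminals `s = 0`, `t = 1`, internal vertices
`v_i = i+1` for `1 ≤ i ≤ n−2`; edges `st`, `s v_i` and `v_i t` for `1 ≤ i ≤ (m−1)/2`
(`m` odd) resp. `1 ≤ i ≤ (m−2)/2` together with `v_1 v_2` (`m` even). -/
def GnmGraph (n m : ℕ) : SimpleGraph (Fin n) :=
  SimpleGraph.fromRel (fun a b =>
    (a.val = 0 ∧ b.val = 1) ∨
    (a.val = 0 ∧ 2 ≤ b.val ∧ b.val ≤ (if m % 2 = 1 then (m-1)/2 else (m-2)/2) + 1) ∨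
    (a.val = 1 ∧ 2 ≤ b.val ∧ b.val ≤ (if m % 2 = 1 then (m-1)/2 else (m-2)/2) + 1) ∨
    (m % 2 = 0 ∧ a.val = 2 ∧ b.val = 3))

def Gnm (n m : ℕ) (hn : 4 ≤ n) : TwoTerminalGraph n where
  graph := GnmGraph n m
  s := ⟨0, by omega⟩
  t := ⟨1, by omega⟩
  hst := by simp [Fin.ext_iff]

namespace LM
open Classical Finset

variable {n : ℕ}

/-- Finset of edges. -/
noncomputable def ef (H : TwoTerminalGraph n) : Finset (Sym2 (Fin n)) :=
  H.graph.edgeSet.toFinset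

/-- common neighbours of the terminals -/
noncomputable def cn (H : TwoTerminalGraph n) : Finset (Fin n) :=
  univ.filter (fun a => H.graph.Adj H.s a ∧ H.graph.Adj a H.t)

/-- base edge set -/
noncomputable def bs (s t : Fin n) (C : Finset (Fin n)) : Finset (Sym2 (Fin n)) :=
  insert s(s,t) (C.image (fun a => s(s,a)) ∪ C.image (fun a => s(t,a)))

def conn (s t : Fin n) (F : Finset (Sym2 (Fin n))) : Prop :=
  (SimpleGraph.fromEdgeSet (F : Set (Sym2 (Fin n)))).Reachable s t

lemma mem_ef (H : TwoTerminalGraph n) (a b : Fin n) : s(a,b) ∈ ef H ↔ H.graph.Adj a b := by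
  simp [ef]

lemma card_ef (H : TwoTerminalGraph n) : (ef H).card = edgeCount H.graph := by
  simp [ef, edgeCount, Set.ncard_eq_toFinset_card']

lemma mem_cn (H : TwoTerminalGraph n) (a : Fin n) :
    a ∈ cn H ↔ H.graph.Adj H.s a ∧ H.graph.Adj a H.t := by simp [cn]

lemma mem_bs (s t : Fin n) (C) (a b : Fin n) : s(a,b) ∈ bs s t C ↔
    (a = s ∧ b = t) ∨ (a = t ∧ b = s) ∨ (a = s ∧ b ∈ C) ∨ (b = s ∧ a ∈ C) ∨
    (a = t ∧ b ∈ C) ∨ (b = t ∧ a ∈ C) := by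
  simp only [bs, mem_insert, mem_union, mem_image, Sym2.eq_iff]
  constructor
  · rintro (h | ⟨c, hc, h⟩ | ⟨c, hc, h⟩) <;> grind
  · rintro (h | h | h | h | h | h)
    · grind
    · grind
    · exact Or.inr (Or.inl ⟨b, h.2, by grind⟩)
    · exact Or.inr (Or.inl ⟨a, h.2, by grind⟩)
    · exact Or.inr (Or.inr ⟨b, h.2, by grind⟩)
    · exact Or.inr (Or.inr ⟨a, h.2, by grind⟩)

lemma card_bs (s t : Fin n) (C : Finset (Fin n)) (hst : s ≠ t) (hs : s ∉ C) (ht : t ∉ C) :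
    (bs s t C).card = 2 * C.card + 1 := by
  have inj : ∀ x : Fin n, Function.Injective (fun a => s(x,a)) := by
    intro x a b h
    simp only [Sym2.eq_iff] at h
    grind
  rw [bs, card_insert_of_notMem, card_union_of_disjoint, card_image_of_injective _ (inj s),
    card_image_of_injective _ (inj t)]
  · ring
  · rw [disjoint_left]
    simp only [mem_image, not_exists, not_and]
    rintro x ⟨a, ha, rfl⟩ b hb h
    simp only [Sym2.eq_iff] at h
    grind
  · simp only [mem_union, mem_image, Sym2.eq_iff]
    grind

lemma Ncoeff_eq (H : TwoTerminalGraph n) (i : ℕ) :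
    Ncoeff H i = (((ef H).powersetCard i).filter (conn H.s H.t)).card := by
  have inj : Function.Injective (fun F : Finset (Sym2 (Fin n)) => (F : Set (Sym2 (Fin n)))) :=
    Finset.coe_injective
  rw [← Set.ncard_coe_finset, ← Set.ncard_image_of_injective _ inj, Ncoeff]
  congr 1
  ext F
  simp only [Set.mem_ofPred_eq, Set.mem_image, mem_coe, mem_filter, mem_powersetCard]
  constructor
  · rintro ⟨h1, h2, h3⟩
    refine ⟨F.toFinset, ⟨⟨?_, ?_⟩, ?_⟩, by simp⟩
    · intro x hx; simp [ef] at *; exact h1 hx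
    · rw [← h2, Set.ncard_eq_toFinset_card']
    · simpa [conn] using h3
  · rintro ⟨F', ⟨⟨h1, h2⟩, h3⟩, rfl⟩
    refine ⟨?_, by simpa using h2, h3⟩
    intro x hx
    have := h1 hx
    simpa [ef] using this

lemma conn_cases {s t : Fin n} {F : Finset (Sym2 (Fin n))} (hst : s ≠ t) (hc : conn s t F)
    (hF : F.card ≤ 3) (hn : s(s,t) ∉ F) :
    (∃ a, a ≠ s ∧ a ≠ t ∧ s(s,a) ∈ F ∧ s(a,t) ∈ F) ∨
    (∃ a b, a ≠ s ∧ a ≠ t ∧ b ≠ s ∧ b ≠ t ∧ a ≠ b ∧ s(s,a) ∈ F ∧ s(a,b) ∈ F ∧ s(b,t) ∈ F) := by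
  obtain ⟨p, hp⟩ := hc.exists_isPath
  have hlen : p.length ≤ 3 := by
    have h1 : p.edges.toFinset ⊆ F := by
      intro e he
      have := p.edges_subset_edgeSet (List.mem_toFinset.1 he)
      simp at this
      exact this.1
    have h2 := card_le_card h1
    rw [List.toFinset_card_of_nodup hp.isTrail.edges_nodup, p.length_edges] at h2
    omega
  cases p with
  | nil => exact absurd rfl hst
  | cons h1 p =>
    rename_i a
    cases p with
    | nil => simp at h1; exact absurd h1.1 hn
    | cons h2 p =>
      rename_i b
      cases p with
      | nil =>
        left
        simp at h1 h2
        exact ⟨a, Ne.symm h1.2, h2.2, h1.1, h2.1⟩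
      | cons h3 p =>
        rename_i c
        cases p with
        | nil =>
          right
          simp at h1 h2 h3 hp
          refine ⟨a, b, ?_⟩
          grind
        | cons h4 p => simp at hlen; omega

lemma conn_two {s t a : Fin n} {F : Finset (Sym2 (Fin n))} (h1 : a ≠ s) (h2 : a ≠ t)
    (h3 : s(s,a) ∈ F) (h4 : s(a,t) ∈ F) : conn s t F := by
  have e1 : (SimpleGraph.fromEdgeSet (F : Set (Sym2 (Fin n)))).Adj s a := by
    simp [h3, h1.symm]
  have e2 : (SimpleGraph.fromEdgeSet (F : Set (Sym2 (Fin n)))).Adj a t := by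
    simp [h4, h2]
  exact e1.reachable.trans e2.reachable

lemma conn_three {s t a b : Fin n} {F : Finset (Sym2 (Fin n))} (h1 : a ≠ s) (h2 : a ≠ b)
    (h0 : b ≠ t)
    (h3 : s(s,a) ∈ F) (h4 : s(a,b) ∈ F) (h5 : s(b,t) ∈ F) : conn s t F := by
  have e1 : (SimpleGraph.fromEdgeSet (F : Set (Sym2 (Fin n)))).Adj s a := by
    simp [h3, h1.symm]
  have e2 : (SimpleGraph.fromEdgeSet (F : Set (Sym2 (Fin n)))).Adj a b := by
    simp [h4, h2]
  have e3 : (SimpleGraph.fromEdgeSet (F : Set (Sym2 (Fin n)))).Adj b t := by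
    simp [h5, h0]
  exact (e1.reachable.trans e2.reachable).trans e3.reachable

/-- connecting sets avoiding st -/
noncomputable def B (H : TwoTerminalGraph n) (i : ℕ) : Finset (Finset (Sym2 (Fin n))) :=
  (((ef H).erase s(H.s,H.t)).powersetCard i).filter (conn H.s H.t)

lemma Ncoeff_B (H : TwoTerminalGraph n) (m i : ℕ) (hm : edgeCount H.graph = m)
    (hst : H.graph.Adj H.s H.t) :
    Ncoeff H i = (m.choose i - (m-1).choose i) + (B H i).card := by
  have hmem : s(H.s,H.t) ∈ ef H := (mem_ef _ _ _).2 hst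
  have hsub : ((ef H).erase s(H.s,H.t)).powersetCard i ⊆ (ef H).powersetCard i :=
    powersetCard_mono (erase_subset _ _)
  have key : ((ef H).powersetCard i).filter (conn H.s H.t) =
      ((ef H).powersetCard i \ ((ef H).erase s(H.s,H.t)).powersetCard i) ∪ B H i := by
    ext F
    simp only [B, mem_filter, mem_union, mem_sdiff, mem_powersetCard, subset_erase]
    by_cases hF : s(H.s,H.t) ∈ F
    · have : conn H.s H.t F := by
        have e1 : (SimpleGraph.fromEdgeSet (F : Set (Sym2 (Fin n)))).Adj H.s H.t := by
          simp [hF, H.hst]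
        exact e1.reachable
      simp [hF, this]
    · simp [hF]
  rw [Ncoeff_eq, key, card_union_of_disjoint, card_sdiff_of_subset hsub, card_powersetCard,
    card_powersetCard, card_erase_of_mem hmem, card_ef, hm]
  rw [disjoint_left]
  intro F h1 h2
  simp only [B, mem_filter, mem_sdiff] at h1 h2
  exact h1.2 h2.1

lemma N1_zero (H : TwoTerminalGraph n) (hst : ¬ H.graph.Adj H.s H.t) : Ncoeff H 1 = 0 := by
  have hst' := H.hst
  rw [Ncoeff_eq, card_eq_zero, filter_eq_empty_iff]
  intro F hF hc
  rw [mem_powersetCard] at hF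
  have hns : s(H.s,H.t) ∉ F := fun h => hst ((mem_ef _ _ _).1 (hF.1 h))
  obtain ⟨e, rfl⟩ := card_eq_one.1 hF.2
  rcases conn_cases H.hst hc (by simp) hns with ⟨a, h⟩ | ⟨a, b, h⟩
  · simp only [mem_singleton] at h
    have := h.2.2.1.trans h.2.2.2.symm
    simp only [Sym2.eq_iff] at this
    grind
  · simp only [mem_singleton] at h
    have := h.2.2.2.2.2.1.trans h.2.2.2.2.2.2.1.symm
    simp only [Sym2.eq_iff] at this
    grind

lemma B1 (H : TwoTerminalGraph n) : (B H 1).card = 0 := by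
  have hst' := H.hst
  rw [B, card_eq_zero, filter_eq_empty_iff]
  intro F hF hc
  rw [mem_powersetCard, subset_erase] at hF
  obtain ⟨e, rfl⟩ := card_eq_one.1 hF.2
  rcases conn_cases H.hst hc (by simp) hF.1.2 with ⟨a, h⟩ | ⟨a, b, h⟩
  · simp only [mem_singleton] at h
    have := h.2.2.1.trans h.2.2.2.symm
    simp only [Sym2.eq_iff] at this
    grind
  · simp only [mem_singleton] at h
    have := h.2.2.2.2.2.1.trans h.2.2.2.2.2.2.1.symm
    simp only [Sym2.eq_iff] at this
    grind

lemma cn_ne {H : TwoTerminalGraph n} {a} (h : a ∈ cn H) : a ≠ H.s ∧ a ≠ H.t := by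
  rw [mem_cn] at h
  exact ⟨h.1.ne', h.2.ne⟩

lemma pair_card {s t a : Fin n} (hst : s ≠ t) (h : a ≠ s) :
    ({s(s,a), s(a,t)} : Finset (Sym2 (Fin n))).card = 2 := by
  apply card_pair
  intro h'
  simp only [Sym2.eq_iff] at h'
  grind

lemma B2 (H : TwoTerminalGraph n) : (B H 2).card = (cn H).card := by
  have hst := H.hst
  have : B H 2 = (cn H).image (fun a => {s(H.s,a), s(a,H.t)}) := by
    ext F
    simp only [B, mem_filter, mem_powersetCard, subset_erase, mem_image]
    constructor
    · rintro ⟨⟨⟨h1, h2⟩, h3⟩, hc⟩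
      rcases conn_cases H.hst hc (by omega) h2 with ⟨a, h⟩ | ⟨a, b, h⟩
      · refine ⟨a, ?_, ?_⟩
        · rw [mem_cn]
          exact ⟨(mem_ef _ _ _).1 (h1 h.2.2.1), (mem_ef _ _ _).1 (h1 h.2.2.2)⟩
        · apply eq_of_subset_of_card_le
          · intro x hx
            simp only [mem_insert, mem_singleton] at hx
            rcases hx with rfl | rfl
            · exact h.2.2.1
            · exact h.2.2.2
          · rw [h3, pair_card hst h.1]
      · exfalso
        obtain ⟨x1, x2, x3, x4, x5, y1, y2, y3⟩ := h
        have : ({s(H.s,a), s(a,b), s(b,H.t)} : Finset _).card ≤ F.card := by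
          apply card_le_card
          intro x hx
          simp only [mem_insert, mem_singleton] at hx
          rcases hx with rfl | rfl | rfl <;> assumption
        rw [card_eq_three.2 ⟨_, _, _, ?_, ?_, ?_, rfl⟩] at this
        · omega
        all_goals
          simp only [ne_eq, Sym2.eq_iff]
          grind
    · rintro ⟨a, ha, rfl⟩
      have hne := cn_ne ha
      rw [mem_cn] at ha
      refine ⟨⟨⟨?_, ?_⟩, pair_card hst hne.1⟩, conn_two hne.1 hne.2 (by simp) (by simp)⟩
      · intro x hx
        simp only [mem_insert, mem_singleton] at hx
        rcases hx with rfl | rfl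
        · exact (mem_ef _ _ _).2 ha.1
        · exact (mem_ef _ _ _).2 ha.2
      · simp only [mem_insert, mem_singleton, Sym2.eq_iff]
        grind
  rw [this]
  apply card_image_of_injOn
  intro a ha b hb hab
  have h1 := cn_ne ha
  have h2 := cn_ne hb
  have : s(H.s,a) ∈ ({s(H.s,b), s(b,H.t)} : Finset (Sym2 (Fin n))) := by
    simp only at hab
    rw [← hab]; simp
  simp only [mem_insert, mem_singleton, Sym2.eq_iff] at this
  grind

/-- index set for 3-sets with a 2-path -/
noncomputable def I3 (H : TwoTerminalGraph n) : Finset ((_ : Fin n) × Sym2 (Fin n)) :=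
  (cn H).sigma (fun a => ((ef H).erase s(H.s,H.t)) \ {s(H.s,a), s(a,H.t)})

def f3 (H : TwoTerminalGraph n) (x : (_ : Fin n) × Sym2 (Fin n)) : Finset (Sym2 (Fin n)) :=
  {s(H.s,x.1), s(x.1,H.t), x.2}

lemma card_I3 (H : TwoTerminalGraph n) (m : ℕ) (hm : edgeCount H.graph = m)
    (hst : H.graph.Adj H.s H.t) : (I3 H).card = (cn H).card * (m - 3) := by
  rw [I3, card_sigma, sum_const_nat]
  intro a ha
  have hne := cn_ne ha
  have hst' := H.hst
  rw [mem_cn] at ha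
  rw [card_sdiff_of_subset, card_erase_of_mem ((mem_ef _ _ _).2 hst), card_ef, hm,
    pair_card H.hst hne.1]
  · omega
  · intro x hx
    simp only [mem_insert, mem_singleton] at hx
    rw [mem_erase]
    rcases hx with rfl | rfl
    · exact ⟨by simp only [ne_eq, Sym2.eq_iff]; grind, (mem_ef _ _ _).2 ha.1⟩
    · exact ⟨by simp only [ne_eq, Sym2.eq_iff]; grind, (mem_ef _ _ _).2 ha.2⟩

lemma B3_le (H : TwoTerminalGraph n)
    (hP : ¬ ∃ a b, a ≠ H.t ∧ b ≠ H.s ∧ H.graph.Adj H.s a ∧ H.graph.Adj a b ∧ H.graph.Adj b H.t) :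
    (B H 3).card ≤ (I3 H).card := by
  have hst := H.hst
  refine le_trans (card_le_card (t := (I3 H).image (f3 H)) ?_) card_image_le
  intro F
  simp only [B, mem_filter, mem_powersetCard, subset_erase, mem_image]
  rintro ⟨⟨⟨h1, h2⟩, h3⟩, hc⟩
  rcases conn_cases H.hst hc (by omega) h2 with ⟨a, h⟩ | ⟨a, b, h⟩
  · have hsub : {s(H.s,a), s(a,H.t)} ⊆ F := by
      intro x hx
      simp only [mem_insert, mem_singleton] at hx
      rcases hx with rfl | rfl
      · exact h.2.2.1
      · exact h.2.2.2
    have hc1 : (F \ {s(H.s,a), s(a,H.t)}).card = 1 := by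
      rw [card_sdiff_of_subset hsub, h3, pair_card hst h.1]
    obtain ⟨e, he⟩ := card_eq_one.1 hc1
    have he' : e ∈ F \ {s(H.s,a), s(a,H.t)} := by rw [he]; simp
    rw [mem_sdiff] at he'
    refine ⟨⟨a, e⟩, ?_, ?_⟩
    · simp only [I3, mem_sigma, mem_cn, mem_sdiff, mem_erase]
      refine ⟨⟨(mem_ef _ _ _).1 (h1 h.2.2.1), (mem_ef _ _ _).1 (h1 h.2.2.2)⟩, ⟨?_, h1 he'.1⟩, he'.2⟩
      rintro rfl
      exact h2 he'.1
    · have := sdiff_union_of_subset hsub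
      rw [he] at this
      rw [← this, f3]
      ext x
      simp only [mem_insert, mem_singleton, mem_union]
      tauto
  · exact absurd ⟨a, b, h.2.1, h.2.2.1, (mem_ef _ _ _).1 (h1 h.2.2.2.2.2.1),
      (mem_ef _ _ _).1 (h1 h.2.2.2.2.2.2.1), (mem_ef _ _ _).1 (h1 h.2.2.2.2.2.2.2)⟩ hP

lemma B3_lt (H : TwoTerminalGraph n) (a b : Fin n) (ha : a ≠ H.t) (hb : b ≠ H.s)
    (h1 : H.graph.Adj H.s a) (h2 : H.graph.Adj a b) (h3 : H.graph.Adj b H.t) :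
    (I3 H).card < (B H 3).card := by
  have hst := H.hst
  have has := h1.ne'
  have hbt := h3.ne
  have hab := h2.ne
  have inj : Set.InjOn (f3 H) (I3 H) := by
    rintro ⟨x, e⟩ hx ⟨y, e'⟩ hy hxy
    simp only [I3, coe_sigma, Set.mem_sigma_iff, mem_coe, mem_sdiff, mem_erase, mem_insert,
      mem_singleton, not_or] at hx hy
    have nx := cn_ne hx.1
    have ny := cn_ne hy.1
    simp only [f3] at hxy
    have m1 : s(H.s,y) ∈ ({s(H.s,x), s(x,H.t), e} : Finset (Sym2 (Fin n))) := by
      rw [hxy]; simp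
    have m2 : s(y,H.t) ∈ ({s(H.s,x), s(x,H.t), e} : Finset (Sym2 (Fin n))) := by
      rw [hxy]; simp
    have m3 : e ∈ ({s(H.s,y), s(y,H.t), e'} : Finset (Sym2 (Fin n))) := by
      rw [← hxy]; simp
    simp only [mem_insert, mem_singleton] at m1 m2 m3
    have hxy' : x = y := by
      by_contra hne
      have q1 : s(H.s,y) = e := by
        rcases m1 with h | h | h
        · simp only [Sym2.eq_iff] at h; grind
        · simp only [Sym2.eq_iff] at h; grind
        · exact h
      have q2 : s(y,H.t) = e := by
        rcases m2 with h | h | h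
        · simp only [Sym2.eq_iff] at h; grind
        · simp only [Sym2.eq_iff] at h; grind
        · exact h
      have := q1.trans q2.symm
      simp only [Sym2.eq_iff] at this
      grind
    subst hxy'
    have : e = e' := by tauto
    subst this
    rfl
  rw [← card_image_of_injOn inj]
  apply card_lt_card
  rw [ssubset_iff]
  refine ⟨{s(H.s,a), s(a,b), s(b,H.t)}, ?_, ?_⟩
  · simp only [mem_image, f3]
    rintro ⟨⟨x, e⟩, hx, h⟩
    simp only [I3, mem_sigma] at hx
    have nx := cn_ne hx.1
    simp only at h
    have m1 : s(H.s,x) ∈ ({s(H.s,a), s(a,b), s(b,H.t)} : Finset (Sym2 (Fin n))) := by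
      rw [← h]; simp
    have m2 : s(x,H.t) ∈ ({s(H.s,a), s(a,b), s(b,H.t)} : Finset (Sym2 (Fin n))) := by
      rw [← h]; simp
    simp only [mem_insert, mem_singleton, Sym2.eq_iff] at m1 m2
    grind
  · intro F hF
    rw [mem_insert] at hF
    simp only [B, mem_filter, mem_powersetCard, subset_erase]
    rcases hF with rfl | hF
    · refine ⟨⟨⟨?_, ?_⟩, ?_⟩, conn_three has hab hbt (by simp) (by simp) (by simp)⟩
      · intro x hx
        simp only [mem_insert, mem_singleton] at hx
        rcases hx with rfl | rfl | rfl <;> rw [mem_ef] <;> assumption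
      · simp only [mem_insert, mem_singleton, Sym2.eq_iff]
        grind
      · rw [card_eq_three.2 ⟨_, _, _, ?_, ?_, ?_, rfl⟩]
        all_goals
          simp only [ne_eq, Sym2.eq_iff]
          grind
    · rw [mem_image] at hF
      obtain ⟨⟨x, e⟩, hx, rfl⟩ := hF
      simp only [I3, mem_sigma, mem_sdiff, mem_erase, mem_insert,
        mem_singleton, not_or] at hx
      have nx := cn_ne hx.1
      have hx1 := hx.1
      rw [mem_cn] at hx1
      simp only [f3]
      refine ⟨⟨⟨?_, ?_⟩, ?_⟩, conn_two nx.1 nx.2 (by simp) (by simp)⟩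
      · intro y hy
        simp only [mem_insert, mem_singleton] at hy
        rcases hy with rfl | rfl | rfl
        · exact (mem_ef _ _ _).2 hx1.1
        · exact (mem_ef _ _ _).2 hx1.2
        · exact hx.2.1.2
      · simp only [mem_insert, mem_singleton, not_or]
        refine ⟨?_, ?_, fun h => hx.2.1.1 h.symm⟩
        all_goals
          simp only [Sym2.eq_iff]
          grind
      · rw [card_eq_three.2 ⟨_, _, _, ?_, ?_, ?_, rfl⟩]
        · simp only [ne_eq, Sym2.eq_iff]
          grind
        · exact fun h => hx.2.2.1 h.symm
        · exact fun h => hx.2.2.2 h.symm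

lemma s_notMem (H : TwoTerminalGraph n) : H.s ∉ cn H := fun h => (cn_ne h).1 rfl
lemma t_notMem (H : TwoTerminalGraph n) : H.t ∉ cn H := fun h => (cn_ne h).2 rfl

lemma bs_sub (H : TwoTerminalGraph n) (hst : H.graph.Adj H.s H.t) :
    bs H.s H.t (cn H) ⊆ ef H := by
  intro e
  induction e with | _ a b => ?_
  rw [mem_bs, mem_ef]
  simp only [mem_cn]
  rintro (h | h | h | h | h | h)
  · rw [h.1, h.2]; exact hst
  · rw [h.1, h.2]; exact hst.symm
  · rw [h.1]; exact h.2.1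
  · rw [h.1]; exact h.2.1.symm
  · rw [h.1]; exact h.2.2.symm
  · rw [h.1]; exact h.2.2

lemma cn_le (H : TwoTerminalGraph n) (m : ℕ) (hm : edgeCount H.graph = m)
    (hst : H.graph.Adj H.s H.t) : 2 * (cn H).card + 1 ≤ m := by
  rw [← card_bs _ _ _ H.hst (s_notMem H) (t_notMem H), ← hm, ← card_ef]
  exact card_le_card (bs_sub H hst)

/-- isomorphism fixing terminals -/
def SIso (H G : TwoTerminalGraph n) : Prop :=
  ∃ e : G.graph ≃g H.graph, e G.s = H.s ∧ e G.t = H.t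

lemma Ncoeff_mono (H G : TwoTerminalGraph n) (e : G.graph ≃g H.graph) (hs : e G.s = H.s)
    (ht : e G.t = H.t) (i : ℕ) : Ncoeff G i ≤ Ncoeff H i := by
  have inj : Function.Injective (Sym2.map e) := Sym2.map.injective e.injective
  apply Set.ncard_le_ncard_of_injOn (fun F => Sym2.map e '' F) _ (inj.image_injective.injOn)
    (Set.toFinite _)
  rintro F ⟨h1, h2, h3⟩
  refine ⟨?_, ?_, ?_⟩
  · rintro _ ⟨x, hx, rfl⟩
    have := h1 hx
    induction x with | _ a b => ?_
    simp only [SimpleGraph.mem_edgeSet, Sym2.map_mk] at this ⊢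
    exact e.map_adj_iff.2 this
  · rw [Set.ncard_image_of_injective _ inj, h2]
  · rw [← hs, ← ht]
    let φ : SimpleGraph.fromEdgeSet F →g SimpleGraph.fromEdgeSet (Sym2.map e '' F) :=
      ⟨e, by
        intro a b h
        rw [SimpleGraph.fromEdgeSet_adj] at h ⊢
        exact ⟨⟨_, h.1, by simp⟩, fun h' => h.2 (e.injective h')⟩⟩
    exact h3.map φ

lemma SIso.relia {H G : TwoTerminalGraph n} (h : SIso H G) (m : ℕ) (p : ℝ) :
    relia m H p = relia m G p := by
  obtain ⟨e, hs, ht⟩ := h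
  have : ∀ i, Ncoeff H i = Ncoeff G i := fun i =>
    le_antisymm (Ncoeff_mono _ _ e.symm (by rw [← hs]; simp) (by rw [← ht]; simp) i)
      (Ncoeff_mono _ _ e hs ht i)
  simp [_root_.relia, this]

lemma relia_lt (H G : TwoTerminalGraph n) (m j : ℕ) (hj : 1 ≤ j) (hjm : j ≤ m)
    (heq : ∀ i, 1 ≤ i → i < j → Ncoeff H i = Ncoeff G i) (hlt : Ncoeff H j < Ncoeff G j) :
    ∃ δ > 0, ∀ p ∈ Set.Ioo (0:ℝ) δ, relia m H p < relia m G p := by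
  let g : ℝ → ℝ := fun p => ∑ i ∈ Icc j m,
    ((Ncoeff G i : ℝ) - Ncoeff H i) * p ^ (i - j) * (1 - p) ^ (m - i)
  have hg : Continuous g := by fun_prop
  have hg0 : 0 < g 0 := by
    have : g 0 = (Ncoeff G j : ℝ) - Ncoeff H j := by
      simp only [g]
      rw [sum_eq_single j]
      · simp
      · intro b hb hbj
        rw [mem_Icc] at hb
        rw [zero_pow (by omega)]; simp
      · intro h; exact absurd (mem_Icc.2 ⟨le_rfl, hjm⟩) h
    rw [this, sub_pos]
    exact_mod_cast hlt
  have hev := hg.continuousAt.eventually (lt_mem_nhds hg0)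
  obtain ⟨δ, hδ, h⟩ := Metric.eventually_nhds_iff.1 hev
  refine ⟨δ, hδ, fun p hp => ?_⟩
  have hgp : 0 < g p := h (by rw [Real.dist_eq, sub_zero, abs_of_pos hp.1]; exact hp.2)
  have hd : relia m G p - relia m H p = p ^ j * g p := by
    simp only [relia, g]
    rw [← sum_sub_distrib, mul_sum]
    symm
    apply sum_subset_zero_on_sdiff (Icc_subset_Icc_left hj)
    · intro i hi
      simp only [mem_sdiff, mem_Icc] at hi
      rw [heq i hi.1.1 (by omega)]; ring
    · intro i hi
      rw [mem_Icc] at hi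
      have : p ^ i = p ^ j * p ^ (i - j) := by rw [← pow_add]; congr 1; omega
      rw [this]; ring
  have := mul_pos (pow_pos hp.1 j) hgp
  linarith

lemma perm_exists (s t : Fin n) (l : List (Fin n)) (hst : s ≠ t) (hs : s ∉ l) (ht : t ∉ l)
    (hl : l.Nodup) (hn : 2 ≤ n) : ∃ σ : Fin n ≃ Fin n,
      σ ⟨0, by omega⟩ = s ∧ σ ⟨1, by omega⟩ = t ∧
      (∀ (i : ℕ) (h : i < l.length) (h' : i + 2 < n), σ ⟨i+2, h'⟩ = l[i]) ∧
      (∀ x : Fin n, σ x ∈ l ↔ 2 ≤ x.val ∧ x.val ≤ l.length + 1) := by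
  set r := (univ \ (s :: t :: l).toFinset : Finset (Fin n)).toList with hr
  set L := s :: t :: (l ++ r) with hL
  have hr' : ∀ x, x ∈ r ↔ ¬ (x = s ∨ x = t ∨ x ∈ l) := by intro x; simp [hr]
  have hrn : r.Nodup := nodup_toList _
  have hnd : L.Nodup := by
    simp only [hL, List.nodup_cons, List.mem_cons, List.mem_append, List.nodup_append, hr']
    grind
  have hall : ∀ x, x ∈ L := by
    intro x
    simp only [hL, List.mem_cons, List.mem_append, hr']
    tauto
  have hlen : L.length = n := by
    rw [← List.toFinset_card_of_nodup hnd]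
    have : L.toFinset = univ := by ext x; simp [hall x]
    rw [this]; simp
  let σ : Fin n ≃ Fin n := (finCongr hlen.symm).trans (hnd.getEquivOfForallMemList L hall)
  have hσ : ∀ x : Fin n, σ x = L[x.val]'(by rw [hlen]; exact x.2) := by
    intro x; simp [σ]
  have h3 : (∀ (i : ℕ) (h : i < l.length) (h' : i + 2 < n), σ ⟨i+2, h'⟩ = l[i]) := by
    intro i h h'
    rw [hσ]
    simp [hL, h]
  refine ⟨σ, ?_, ?_, h3, ?_⟩
  · rw [hσ]; simp [hL]
  · rw [hσ]; simp [hL]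
  · intro x
    constructor
    · intro hx
      obtain ⟨i, hi, he⟩ := List.mem_iff_getElem.1 hx
      have hi2 : i + 2 < n := by
        rw [← hlen]; simp [hL]; omega
      have := h3 i hi hi2
      rw [he] at this
      have := σ.injective this
      subst this
      simp; omega
    · rintro ⟨h1, h2⟩
      have hx : x = ⟨(x.val - 2) + 2, by omega⟩ := by ext; simp; omega
      rw [hx, h3 _ (by omega)]
      exact List.getElem_mem _

lemma Gadj (n m : ℕ) (hn : 4 ≤ n) (hm : 5 ≤ m) (a b : Fin n) : (Gnm n m hn).graph.Adj a b ↔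
    (((a.val = 0 ∧ b.val = 1) ∨ (a.val = 1 ∧ b.val = 0) ∨
    (a.val = 0 ∧ (2 ≤ b.val ∧ b.val ≤ (m-1)/2 + 1)) ∨
    (b.val = 0 ∧ (2 ≤ a.val ∧ a.val ≤ (m-1)/2 + 1)) ∨
    (a.val = 1 ∧ (2 ≤ b.val ∧ b.val ≤ (m-1)/2 + 1)) ∨
    (b.val = 1 ∧ (2 ≤ a.val ∧ a.val ≤ (m-1)/2 + 1))) ∨
    (m % 2 = 0 ∧ ((a.val = 2 ∧ b.val = 3) ∨ (a.val = 3 ∧ b.val = 2)))) := by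
  have hk : (if m % 2 = 1 then (m-1)/2 else (m-2)/2) = (m-1)/2 := by split_ifs <;> omega
  simp only [Gnm, GnmGraph, SimpleGraph.fromRel_adj, hk, ne_eq, Fin.ext_iff]
  omega

lemma iso_of (n m : ℕ) (hn : 4 ≤ n) (hm : 5 ≤ m) (hm2 : m ≤ 2*n - 3) (H : TwoTerminalGraph n)
    (l : List (Fin n)) (hl : l.Nodup) (hs : H.s ∉ l) (ht : H.t ∉ l) (hk : l.length = (m-1)/2)
    (hadj : ∀ x y, H.graph.Adj x y ↔
      (((x = H.s ∧ y = H.t) ∨ (x = H.t ∧ y = H.s) ∨ (x = H.s ∧ y ∈ l) ∨ (y = H.s ∧ x ∈ l) ∨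
      (x = H.t ∧ y ∈ l) ∨ (y = H.t ∧ x ∈ l)) ∨
      (m % 2 = 0 ∧ ((x = l[0]'(by omega) ∧ y = l[1]'(by omega)) ∨
        (x = l[1]'(by omega) ∧ y = l[0]'(by omega)))))) :
    SIso H (Gnm n m hn) := by
  obtain ⟨σ, h0, h1, h2, h3⟩ := perm_exists H.s H.t l H.hst hs ht hl (by omega)
  have e0 : ∀ x : Fin n, σ x = H.s ↔ x.val = 0 := by
    intro x; rw [← h0, σ.apply_eq_iff_eq, Fin.ext_iff]
  have e1 : ∀ x : Fin n, σ x = H.t ↔ x.val = 1 := by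
    intro x; rw [← h1, σ.apply_eq_iff_eq, Fin.ext_iff]
  have e2 : ∀ x : Fin n, σ x = l[0]'(by omega) ↔ x.val = 2 := by
    intro x; rw [← h2 0 (by omega) (by omega), σ.apply_eq_iff_eq, Fin.ext_iff]
  have e3 : ∀ x : Fin n, σ x = l[1]'(by omega) ↔ x.val = 3 := by
    intro x; rw [← h2 1 (by omega) (by omega), σ.apply_eq_iff_eq, Fin.ext_iff]
  refine ⟨⟨σ, ?_⟩, ?_, ?_⟩
  · intro a b
    rw [hadj, Gadj n m hn hm]
    simp only [e0, e1, e2, e3, h3, hk]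
  · exact h0
  · exact h1

/-- the internal vertices of Gnm -/
def CG (n m : ℕ) : Finset (Fin n) := univ.filter (fun a => 2 ≤ a.val ∧ a.val ≤ (m-1)/2 + 1)

lemma card_CG (n m : ℕ) (hn : 4 ≤ n) (hm : 5 ≤ m) (hm2 : m ≤ 2*n - 3) :
    (CG n m).card = (m-1)/2 := by
  have : (CG n m).image Fin.val = Icc 2 ((m-1)/2+1) := by
    ext x
    simp only [CG, mem_image, mem_filter, mem_univ, true_and, mem_Icc]
    constructor
    · rintro ⟨a, h, rfl⟩; exact h
    · intro h; exact ⟨⟨x, by omega⟩, h, rfl⟩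
  rw [← card_image_of_injective _ Fin.val_injective, this]
  simp

lemma cn_G (n m : ℕ) (hn : 4 ≤ n) (hm : 5 ≤ m) : cn (Gnm n m hn) = CG n m := by
  ext x
  rw [mem_cn, Gadj n m hn hm, Gadj n m hn hm]
  simp only [Gnm, CG, mem_filter, mem_univ, true_and]
  omega

lemma G_st (n m : ℕ) (hn : 4 ≤ n) (hm : 5 ≤ m) :
    (Gnm n m hn).graph.Adj (Gnm n m hn).s (Gnm n m hn).t := by
  rw [Gadj n m hn hm]; simp [Gnm]

lemma G_mem (n m : ℕ) (hn : 4 ≤ n) (hm : 5 ≤ m) (hm2 : m ≤ 2*n - 3) :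
    edgeCount (Gnm n m hn).graph = m := by
  have hb := card_bs _ _ _ (Gnm n m hn).hst (s_notMem _) (t_notMem _)
  rw [cn_G n m hn hm, card_CG n m hn hm hm2] at hb
  rw [← card_ef]
  rcases Nat.mod_two_eq_zero_or_one m with h | h
  · have : ef (Gnm n m hn) = insert s(⟨2, by omega⟩, ⟨3, by omega⟩)
        (bs (Gnm n m hn).s (Gnm n m hn).t (CG n m)) := by
      ext e
      induction e with | _ a b => ?_
      rw [mem_ef, mem_insert, mem_bs, Gadj n m hn hm]
      simp only [Gnm, CG, mem_filter, mem_univ, true_and, Fin.ext_iff, Sym2.eq_iff]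
      omega
    rw [this, card_insert_of_notMem, hb]
    · omega
    · rw [mem_bs]
      simp [Gnm, Fin.ext_iff]
  · have : ef (Gnm n m hn) = bs (Gnm n m hn).s (Gnm n m hn).t (CG n m) := by
      ext e
      induction e with | _ a b => ?_
      rw [mem_ef, mem_bs, Gadj n m hn hm]
      simp only [Gnm, CG, mem_filter, mem_univ, true_and, Fin.ext_iff]
      omega
    rw [this, hb]
    omega

lemma odd_iso (n m : ℕ) (hn : 4 ≤ n) (hm : 5 ≤ m) (hm2 : m ≤ 2*n - 3) (H : TwoTerminalGraph n)
    (hH : edgeCount H.graph = m) (hst : H.graph.Adj H.s H.t) (hc : (cn H).card = (m-1)/2)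
    (ho : m % 2 = 1) : SIso H (Gnm n m hn) := by
  have hE : bs H.s H.t (cn H) = ef H := by
    apply eq_of_subset_of_card_le (bs_sub H hst)
    rw [card_ef, hH, card_bs _ _ _ H.hst (s_notMem H) (t_notMem H)]
    omega
  apply iso_of n m hn hm hm2 H (cn H).toList (nodup_toList _) (by simpa using s_notMem H)
    (by simpa using t_notMem H) (by simpa using hc)
  intro x y
  rw [← mem_ef, ← hE, mem_bs]
  simp only [mem_toList, ho]
  simp

lemma even_iso (n m : ℕ) (hn : 4 ≤ n) (hm : 5 ≤ m) (hm2 : m ≤ 2*n - 3) (H : TwoTerminalGraph n)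
    (hH : edgeCount H.graph = m) (hst : H.graph.Adj H.s H.t) (hc : (cn H).card = (m-1)/2)
    (ho : m % 2 = 0) (a b : Fin n) (ha : a ≠ H.t) (hb : b ≠ H.s)
    (h1 : H.graph.Adj H.s a) (h2 : H.graph.Adj a b) (h3 : H.graph.Adj b H.t) :
    SIso H (Gnm n m hn) := by
  have has := h1.ne'
  have hbt := h3.ne
  have hab := h2.ne
  have hne := H.hst
  have hnb : s(a,b) ∉ bs H.s H.t (cn H) := by
    rw [mem_bs]; grind
  have hE : insert s(a,b) (bs H.s H.t (cn H)) = ef H := by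
    apply eq_of_subset_of_card_le
    · rw [insert_subset_iff]
      exact ⟨(mem_ef _ _ _).2 h2, bs_sub H hst⟩
    · rw [card_insert_of_notMem hnb, card_ef, hH,
        card_bs _ _ _ H.hst (s_notMem H) (t_notMem H)]
      omega
  have haC : a ∈ cn H := by
    have := (mem_ef _ _ _).2 h1
    rw [← hE, mem_insert, mem_bs, Sym2.eq_iff] at this
    have := s_notMem H
    grind
  have hbC : b ∈ cn H := by
    have := (mem_ef _ _ _).2 h3
    rw [← hE, mem_insert, mem_bs, Sym2.eq_iff] at this
    have := t_notMem H
    grind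
  have hmem : ∀ x, x ∈ a :: b :: (cn H \ {a, b}).toList ↔ x ∈ cn H := by
    intro x
    simp only [List.mem_cons, mem_toList, mem_sdiff, mem_insert, mem_singleton]
    grind
  have hnd : (a :: b :: (cn H \ {a, b}).toList).Nodup := by
    simp only [List.nodup_cons, List.mem_cons, mem_toList, mem_sdiff, mem_insert, mem_singleton,
      nodup_toList]
    grind
  have hlen : (a :: b :: (cn H \ {a, b}).toList).length = (m-1)/2 := by
    rw [← hc, ← List.toFinset_card_of_nodup hnd]
    congr 1
    ext x
    rw [List.mem_toFinset, hmem]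
  apply iso_of n m hn hm hm2 H (a :: b :: (cn H \ {a, b}).toList) hnd
    (by rw [hmem]; exact s_notMem H) (by rw [hmem]; exact t_notMem H) hlen
  intro x y
  rw [← mem_ef, ← hE, mem_insert, mem_bs, Sym2.eq_iff]
  simp only [hmem, ho, List.getElem_cons_zero, List.getElem_cons_succ, true_and]
  rw [or_comm]

lemma main (n m : ℕ) (hn : 4 ≤ n) (hm : 5 ≤ m) (hm2 : m ≤ 2*n - 3) (H : TwoTerminalGraph n)
    (hH : edgeCount H.graph = m) : SIso H (Gnm n m hn) ∨
    ∃ δ > 0, ∀ p ∈ Set.Ioo (0:ℝ) δ, relia m H p < relia m (Gnm n m hn) p := by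
  have hG := G_mem n m hn hm hm2
  have hGst := G_st n m hn hm
  have hGc : (cn (Gnm n m hn)).card = (m-1)/2 := by
    rw [cn_G n m hn hm, card_CG n m hn hm hm2]
  have g1 := Ncoeff_B (Gnm n m hn) m 1 hG hGst
  have g2 := Ncoeff_B (Gnm n m hn) m 2 hG hGst
  have g3 := Ncoeff_B (Gnm n m hn) m 3 hG hGst
  rw [B1] at g1
  rw [B2, hGc] at g2
  by_cases hst : H.graph.Adj H.s H.t
  · have k1 := Ncoeff_B H m 1 hH hst
    have k2 := Ncoeff_B H m 2 hH hst
    have k3 := Ncoeff_B H m 3 hH hst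
    rw [B1] at k1
    rw [B2] at k2
    have hle := cn_le H m hH hst
    by_cases hc : (cn H).card = (m-1)/2
    · rcases Nat.mod_two_eq_zero_or_one m with ho | ho
      · by_cases hP : ∃ a b, a ≠ H.t ∧ b ≠ H.s ∧ H.graph.Adj H.s a ∧ H.graph.Adj a b ∧
            H.graph.Adj b H.t
        · left
          obtain ⟨a, b, ha, hb, h1, h2, h3⟩ := hP
          exact even_iso n m hn hm hm2 H hH hst hc ho a b ha hb h1 h2 h3
        · right
          have u1 := B3_le H hP
          rw [card_I3 H m hH hst, hc] at u1
          have u2 := B3_lt (Gnm n m hn) ⟨2, by omega⟩ ⟨3, by omega⟩ (by simp [Gnm, Fin.ext_iff])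
            (by simp [Gnm, Fin.ext_iff])
            (by rw [Gadj n m hn hm]; simp [Gnm]; omega)
            (by rw [Gadj n m hn hm]; simp [ho])
            (by rw [Gadj n m hn hm]; simp [Gnm]; omega)
          rw [card_I3 _ m hG hGst, hGc] at u2
          apply relia_lt H _ m 3 (by omega) (by omega)
          · intro i hi1 hi3
            interval_cases i
            · rw [k1, g1]
            · rw [k2, g2, hc]
          · omega
      · left
        exact odd_iso n m hn hm hm2 H hH hst hc ho
    · right
      apply relia_lt H _ m 2 (by omega) (by omega)
      · intro i hi1 hi3
        interval_cases i
        rw [k1, g1]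
      · omega
  · right
    have k1 := N1_zero H hst
    apply relia_lt H _ m 1 (by omega) (by omega)
    · intro i hi1 hi3; omega
    · rw [k1, g1]
      simp only [Nat.choose_one_right]
      omega

lemma SIso.ttiso {H G : TwoTerminalGraph n} (h : SIso H G) : TTIso H G := by
  obtain ⟨e, hs, ht⟩ := h
  exact ⟨e.symm, Or.inl ⟨by rw [← hs]; simp, by rw [← ht]; simp⟩⟩

end LM

theorem stmt1 (n m : ℕ) (hn : 4 ≤ n) (hm1 : 5 ≤ m) (hm2 : m ≤ 2*n - 3) :
    IsLMRTTG n m (Gnm n m hn) ∧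
      ∀ H : TwoTerminalGraph n, IsLMRTTG n m H → TTIso H (Gnm n m hn) := by
  have hG := LM.G_mem n m hn hm1 hm2
  refine ⟨⟨hG, fun H hH => ?_⟩, fun H hH => ?_⟩
  · rcases LM.main n m hn hm1 hm2 H hH with h | ⟨δ, hδ, h⟩
    · exact ⟨1, one_pos, fun p _ => (h.relia m p).le⟩
    · exact ⟨δ, hδ, fun p hp => (h p hp).le⟩
  · rcases LM.main n m hn hm1 hm2 H hH.1 with h | ⟨δ, hδ, h⟩
    · exact h.ttiso
    · exfalso
      obtain ⟨δ', hδ', h'⟩ := hH.2 _ hG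
      have hmin : 0 < min δ δ' := lt_min hδ hδ'
      have q1 : min δ δ' / 2 < δ := by have := min_le_left δ δ'; linarith
      have q2 : min δ δ' / 2 < δ' := by have := min_le_right δ δ'; linarith
      exact absurd (h _ ⟨half_pos hmin, q1⟩) (not_lt.2 (h' _ ⟨half_pos hmin, q2⟩))
end
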